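/- Let H = N⋊T be the smash product of cocommutative Hopf algebras N and T over a field k, and let the commutative k-algebra A be a trivial H-module. Then: (i) the restriction to N⊗N of any Sweedler 2-cocycle on H representing a class of H̃²(H,A) is a 2-cocycle on N whose class is T-stable; (ii) the five-term sequence 0 → H¹_meas(T,Hom(N,A)) →(ι) H̃²(H,A) →(res) H²(N,A)^T →(d) H²_meas(T,Hom(N,A)) →(j) H̃³(H,A) is exact, where ι sends the class of a measuring 1-cocycle f to the class of the Sweedler 2-cocycle (n⋊t)⊗(n'⋊t') ↦ ε(n) f(t)(n') ε(t'); res is induced by restriction of cocycles to N⊗N; d sends the class of a 2-cocycle f on N with stability witness g: T⊗N → A to the class of the measuring 2-cocycle f'(t⊗t')(n) = ∑ g(t'_(1)⊗n_(1)) g^{-1}(t_(1)t'_(2)⊗n_(2)) g(t_(2)⊗t'_(3)(n_(3))) (a class independent of the choice of witness g); and j sends the class of a measuring 2-cocycle f to the class of the Sweedler 3-cocycle (n⋊t)⊗(n'⋊t')⊗(n''⋊t'') ↦ ε(n)ε(n') f(t⊗t')(n'') ε(t''). -/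

import Mathlib

open TensorProduct

namespace SmashPaper

variable (k : Type) [Field k]

section Conv

variable {k : Type} [Field k] {C A : Type} [AddCommGroup C] [Module k C] [Coalgebra k C]
  [CommRing A] [Algebra k A]

/-- Convolution product on linear maps from a coalgebra to an algebra. -/
noncomputable def conv (f g : C →ₗ[k] A) : C →ₗ[k] A :=
  LinearMap.mul' k A ∘ₗ TensorProduct.map f g ∘ₗ Coalgebra.comul

/-- Convolution unit. -/
noncomputable def convOne (C A : Type) [AddCommGroup C] [Module k C] [Coalgebra k C]
    [CommRing A] [Algebra k A] : C →ₗ[k] A :=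
  Algebra.linearMap k A ∘ₗ Coalgebra.counit

def IsConvInv (f g : C →ₗ[k] A) : Prop :=
  conv f g = convOne C A ∧ conv g f = convOne C A

def IsConvInvertible (f : C →ₗ[k] A) : Prop := ∃ g, IsConvInv f g

end Conv

/-- Cocommutativity of a coalgebra. -/
def IsCocomm (C : Type) [AddCommGroup C] [Module k C] [Coalgebra k C] : Prop :=
  (TensorProduct.comm k C C).toLinearMap ∘ₗ Coalgebra.comul
    = (Coalgebra.comul : C →ₗ[k] C ⊗[k] C)

section Drop

variable {k : Type} [Field k] (C D : Type) [AddCommGroup C] [Module k C]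
  [AddCommGroup D] [Module k D]

/-- `c ⊗ d ↦ ε(c) d`. -/
noncomputable def dropL [Coalgebra k C] : C ⊗[k] D →ₗ[k] D :=
  (TensorProduct.lid k D).toLinearMap ∘ₗ LinearMap.rTensor D (Coalgebra.counit (R := k))

/-- `c ⊗ d ↦ ε(d) c`. -/
noncomputable def dropR [Coalgebra k D] : C ⊗[k] D →ₗ[k] C :=
  (TensorProduct.rid k C).toLinearMap ∘ₗ LinearMap.lTensor C (Coalgebra.counit (R := k))

end Drop

section Sweedler

variable {k : Type} [Field k] (H A : Type) [Ring H] [Bialgebra k H]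
  [CommRing A] [Algebra k A]

variable {H A}

/-- Normalization for 1-cochains. -/
def Normalized1 (t : H →ₗ[k] A) : Prop := t 1 = 1

/-- Normalization for 2-cochains: trivial whenever an argument is a scalar. -/
def Normalized2 (f : H ⊗[k] H →ₗ[k] A) : Prop :=
  ∀ x : H, f (1 ⊗ₜ[k] x) = algebraMap k A (Coalgebra.counit x)
    ∧ f (x ⊗ₜ[k] 1) = algebraMap k A (Coalgebra.counit x)

/-- Normalization for 3-cochains. -/
def Normalized3 (f : (H ⊗[k] H) ⊗[k] H →ₗ[k] A) : Prop :=
  ∀ x y : H,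
    f ((1 ⊗ₜ[k] x) ⊗ₜ[k] y) = algebraMap k A (Coalgebra.counit x * Coalgebra.counit y)
    ∧ f ((x ⊗ₜ[k] 1) ⊗ₜ[k] y) = algebraMap k A (Coalgebra.counit x * Coalgebra.counit y)
    ∧ f ((x ⊗ₜ[k] y) ⊗ₜ[k] 1) = algebraMap k A (Coalgebra.counit x * Coalgebra.counit y)

/-- `∑ f(x₍₁₎ ⊗ y₍₁₎) f(x₍₂₎y₍₂₎ ⊗ z)` as a linear map on `(H ⊗ H) ⊗ H`. -/
noncomputable def cocycle2LHS (f : H ⊗[k] H →ₗ[k] A) : (H ⊗[k] H) ⊗[k] H →ₗ[k] A :=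
  conv (f ∘ₗ dropR (H ⊗[k] H) H) (f ∘ₗ LinearMap.rTensor H (LinearMap.mul' k H))

/-- `∑ f(y₍₁₎ ⊗ z₍₁₎) f(x ⊗ y₍₂₎z₍₂₎)` as a linear map on `(H ⊗ H) ⊗ H`. -/
noncomputable def cocycle2RHS (f : H ⊗[k] H →ₗ[k] A) : (H ⊗[k] H) ⊗[k] H →ₗ[k] A :=
  conv (f ∘ₗ dropL H (H ⊗[k] H) ∘ₗ (TensorProduct.assoc k H H H).toLinearMap)
       (f ∘ₗ LinearMap.lTensor H (LinearMap.mul' k H) ∘ₗ (TensorProduct.assoc k H H H).toLinearMap)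

/-- Sweedler 2-cocycles (for the trivial action). -/
def IsZ2 (f : H ⊗[k] H →ₗ[k] A) : Prop :=
  Normalized2 f ∧ IsConvInvertible f ∧ cocycle2LHS f = cocycle2RHS f

/-- The Sweedler 2-coboundary `∑ t(y₍₁₎) t⁻¹(x₍₁₎y₍₂₎) t(x₍₂₎)` of a 1-cochain `t`
with convolution inverse `tinv`. -/
noncomputable def cobound2 (t tinv : H →ₗ[k] A) : H ⊗[k] H →ₗ[k] A :=
  conv (t ∘ₗ dropL H H) (conv (tinv ∘ₗ LinearMap.mul' k H) (t ∘ₗ dropR H H))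

/-- Sweedler 2-coboundaries (for the trivial action). -/
def IsB2 (f : H ⊗[k] H →ₗ[k] A) : Prop :=
  ∃ t tinv : H →ₗ[k] A, Normalized1 t ∧ IsConvInv t tinv ∧ f = cobound2 t tinv

/-- Two 2-cochains are cohomologous when they differ (in convolution) by a 2-coboundary. -/
def Cohomologous2 (f f' : H ⊗[k] H →ₗ[k] A) : Prop :=
  ∃ b, IsB2 b ∧ f = conv f' b

/-- `(x⊗y)⊗z ↦ x ⊗ yz`. -/
noncomputable def m23 : (H ⊗[k] H) ⊗[k] H →ₗ[k] H ⊗[k] H :=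
  LinearMap.lTensor H (LinearMap.mul' k H) ∘ₗ (TensorProduct.assoc k H H H).toLinearMap

/-- `(x⊗y)⊗z ↦ ε(x) (y⊗z)`. -/
noncomputable def p23 : (H ⊗[k] H) ⊗[k] H →ₗ[k] H ⊗[k] H :=
  dropL H (H ⊗[k] H) ∘ₗ (TensorProduct.assoc k H H H).toLinearMap

/-- 3-cocycle condition
`∑ f(y₁⊗z₁⊗w₁) f(x₁⊗y₂z₂⊗w₂) f(x₂⊗y₃⊗z₃) = ∑ f(x₁y₁⊗z₁⊗w₁) f(x₂⊗y₂⊗z₂w₂)`. -/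
def IsZ3cond (f : (H ⊗[k] H) ⊗[k] H →ₗ[k] A) : Prop :=
  conv (f ∘ₗ LinearMap.rTensor H (LinearMap.rTensor H (dropL H H)))
    (conv (f ∘ₗ LinearMap.rTensor H (m23 (H := H)))
          (f ∘ₗ dropR ((H ⊗[k] H) ⊗[k] H) H))
  = conv (C := ((H ⊗[k] H) ⊗[k] H) ⊗[k] H)
         (f ∘ₗ LinearMap.rTensor H (LinearMap.rTensor H (LinearMap.mul' k H)))
         (f ∘ₗ (LinearMap.lTensor (H ⊗[k] H) (LinearMap.mul' k H)
              ∘ₗ (TensorProduct.assoc k (H ⊗[k] H) H H).toLinearMap :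
                ((H ⊗[k] H) ⊗[k] H) ⊗[k] H →ₗ[k] (H ⊗[k] H) ⊗[k] H))

/-- Sweedler 3-cocycles (for the trivial action). -/
def IsZ3 (f : (H ⊗[k] H) ⊗[k] H →ₗ[k] A) : Prop :=
  Normalized3 f ∧ IsConvInvertible f ∧ IsZ3cond f

/-- The Sweedler 3-coboundary
`∑ v(y₁⊗z₁) v⁻¹(x₁y₂⊗z₂) v(x₂⊗y₃z₃) v⁻¹(x₃⊗y₄)` of a 2-cochain `v`. -/
noncomputable def cobound3 (v vinv : H ⊗[k] H →ₗ[k] A) : (H ⊗[k] H) ⊗[k] H →ₗ[k] A :=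
  conv (v ∘ₗ p23 (H := H))
    (conv (vinv ∘ₗ LinearMap.rTensor H (LinearMap.mul' k H))
      (conv (v ∘ₗ m23 (H := H)) (vinv ∘ₗ dropR (H ⊗[k] H) H)))

/-- Sweedler 3-coboundaries (for the trivial action). -/
def IsB3 (f : (H ⊗[k] H) ⊗[k] H →ₗ[k] A) : Prop :=
  ∃ v vinv : H ⊗[k] H →ₗ[k] A, Normalized2 v ∧ IsConvInv v vinv ∧ f = cobound3 v vinv

/-- Cohomologous 3-cochains. -/
def Cohomologous3 (f f' : (H ⊗[k] H) ⊗[k] H →ₗ[k] A) : Prop :=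
  ∃ b, IsB3 b ∧ f = conv f' b

end Sweedler

section Measuring

variable {k : Type} [Field k]
variable {C : Type} [AddCommGroup C] [Module k C] [Coalgebra k C]
variable {N : Type} [Ring N] [Bialgebra k N]
variable {A : Type} [CommRing A] [Algebra k A]

/-- `(C, θ)` measures `N` to `A`:
`∑ θ(c₍₁₎ ⊗ n) θ(c₍₂₎ ⊗ n') = θ(c ⊗ nn')` and `θ(c ⊗ 1) = ε(c) 1`. -/
def Measures (θ : C ⊗[k] N →ₗ[k] A) : Prop :=
  (θ ∘ₗ LinearMap.lTensor C (LinearMap.mul' k N)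
    = conv (θ ∘ₗ LinearMap.lTensor C (dropR N N)) (θ ∘ₗ LinearMap.lTensor C (dropL N N)))
  ∧ ∀ c : C, θ (c ⊗ₜ[k] (1 : N)) = algebraMap k A (Coalgebra.counit c)

end Measuring

section Action

variable {k : Type} [Field k]
variable {T N : Type} [Ring T] [Bialgebra k T] [Ring N] [Bialgebra k N]

/-- `μ : T ⊗ N → N` makes `N` a left `T`-module bialgebra. -/
structure IsModuleBialgebra (μ : T ⊗[k] N →ₗ[k] N) : Prop where
  one_act : ∀ n : N, μ ((1 : T) ⊗ₜ[k] n) = n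
  mul_act : ∀ (t s : T) (n : N), μ ((t * s) ⊗ₜ[k] n) = μ (t ⊗ₜ[k] μ (s ⊗ₜ[k] n))
  act_one : ∀ t : T, μ (t ⊗ₜ[k] (1 : N)) = algebraMap k N (Coalgebra.counit t)
  act_mul : μ ∘ₗ LinearMap.lTensor T (LinearMap.mul' k N)
      = LinearMap.mul' k N ∘ₗ TensorProduct.map μ μ
          ∘ₗ (TensorProduct.tensorTensorTensorComm k T T N N).toLinearMap
          ∘ₗ LinearMap.rTensor (N ⊗[k] N) Coalgebra.comul
  comul_act : Coalgebra.comul ∘ₗ μ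
      = TensorProduct.map μ μ
          ∘ₗ (TensorProduct.tensorTensorTensorComm k T T N N).toLinearMap
          ∘ₗ TensorProduct.map Coalgebra.comul Coalgebra.comul
  counit_act : ∀ (t : T) (n : N),
      Coalgebra.counit (R := k) (μ (t ⊗ₜ[k] n))
        = Coalgebra.counit (R := k) t * Coalgebra.counit (R := k) n

/-- `t ⊗ n ↦ ∑ t₍₁₎(n) ⊗ t₍₂₎`. -/
noncomputable def smashCross (μ : T ⊗[k] N →ₗ[k] N) : T ⊗[k] N →ₗ[k] N ⊗[k] T :=
  TensorProduct.map μ LinearMap.id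
    ∘ₗ (TensorProduct.assoc k T N T).symm.toLinearMap
    ∘ₗ LinearMap.lTensor T (TensorProduct.comm k T N).toLinearMap
    ∘ₗ (TensorProduct.assoc k T T N).toLinearMap
    ∘ₗ LinearMap.rTensor N Coalgebra.comul

variable {H : Type} [Ring H] [Bialgebra k H]

/-- `H` is the smash product `N ⋊ T` along the action `μ`, with `N` and `T` included
as the Hopf subalgebras `N ⋊ 1` and `1 ⋊ T`; we identify `n ⋊ t = n t`. -/
structure IsSmashProduct (μ : T ⊗[k] N →ₗ[k] N) (iN : N →ₐc[k] H) (iT : T →ₐc[k] H) : Prop where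
  act : IsModuleBialgebra μ
  injN : Function.Injective iN
  injT : Function.Injective iT
  /-- `n ⊗ t ↦ (n ⋊ 1)(1 ⋊ t)` is a linear isomorphism `N ⊗ T ≅ H` (`H` is the
  tensor product coalgebra `N ⊗ T`). -/
  bij : Function.Bijective
    (LinearMap.mul' k H ∘ₗ TensorProduct.map (iN : N →ₗ[k] H) (iT : T →ₗ[k] H))
  /-- The smash relation `t n = ∑ t₍₁₎(n) t₍₂₎` in `H`. -/
  straighten : LinearMap.mul' k H ∘ₗ TensorProduct.map (iT : T →ₗ[k] H) (iN : N →ₗ[k] H)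
      = LinearMap.mul' k H ∘ₗ TensorProduct.map (iN : N →ₗ[k] H) (iT : T →ₗ[k] H)
          ∘ₗ smashCross μ

end Action

section MeasCohomology

variable {k : Type} [Field k]
variable {T N : Type} [Ring T] [Bialgebra k T] [Ring N] [Bialgebra k N]
variable {A : Type} [CommRing A] [Algebra k A]

/-- Normalization in the `T`-variable for measuring 1-cochains `T ⊗ N → A`. -/
def MeasNormalized1 (f : T ⊗[k] N →ₗ[k] A) : Prop :=
  ∀ n : N, f ((1 : T) ⊗ₜ[k] n) = algebraMap k A (Coalgebra.counit n)

/-- A measuring 1-cochain: an element of `Reg_meas(T, Hom(N,A))`. -/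
def IsRegMeas1 (f : T ⊗[k] N →ₗ[k] A) : Prop :=
  Measures f ∧ MeasNormalized1 f ∧ IsConvInvertible f

/-- The measuring 1-cocycle condition `f(ts)(n) = ∑ f(s₍₁₎)(n₍₁₎) f(t)(s₍₂₎(n₍₂₎))`. -/
def MeasCocycle1 (μ : T ⊗[k] N →ₗ[k] N) (f : T ⊗[k] N →ₗ[k] A) : Prop :=
  f ∘ₗ LinearMap.rTensor N (LinearMap.mul' k T)
    = conv (f ∘ₗ LinearMap.rTensor N (dropL T T))
      (f ∘ₗ LinearMap.lTensor T μ ∘ₗ (TensorProduct.assoc k T T N).toLinearMap)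

/-- Measuring 1-cocycles. -/
def IsMeasZ1 (μ : T ⊗[k] N →ₗ[k] N) (f : T ⊗[k] N →ₗ[k] A) : Prop :=
  IsRegMeas1 f ∧ MeasCocycle1 μ f

/-- Measuring 1-coboundaries: `f(t)(n) = ∑ g(n₍₁₎) g⁻¹(t(n₍₂₎))` for a
convolution-invertible algebra map `g : N → A`. -/
def IsMeasB1 (μ : T ⊗[k] N →ₗ[k] N) (f : T ⊗[k] N →ₗ[k] A) : Prop :=
  ∃ (g : N →ₐ[k] A) (ginv : N →ₗ[k] A), IsConvInv g.toLinearMap ginv ∧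
    f = conv (g.toLinearMap ∘ₗ dropL T N) (ginv ∘ₗ μ)

/-- Normalization for measuring 2-cochains `(T ⊗ T) ⊗ N → A`. -/
def MeasNormalized2 (f : (T ⊗[k] T) ⊗[k] N →ₗ[k] A) : Prop :=
  ∀ (t : T) (n : N),
    f (((1 : T) ⊗ₜ[k] t) ⊗ₜ[k] n)
        = algebraMap k A (Coalgebra.counit t * Coalgebra.counit n)
    ∧ f ((t ⊗ₜ[k] (1 : T)) ⊗ₜ[k] n)
        = algebraMap k A (Coalgebra.counit t * Coalgebra.counit n)

/-- A measuring 2-cochain: an element of `Reg_meas(T ⊗ T, Hom(N,A))`. -/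
def IsRegMeas2 (f : (T ⊗[k] T) ⊗[k] N →ₗ[k] A) : Prop :=
  Measures f ∧ MeasNormalized2 f ∧ IsConvInvertible f

/-- The measuring 2-cocycle condition
`∑ f(t₍₁₎⊗s₍₁₎)(r₍₁₎(n₍₁₎)) f(t₍₂₎s₍₂₎⊗r₍₂₎)(n₍₂₎) = ∑ f(s₍₁₎⊗r₍₁₎)(n₍₁₎) f(t⊗s₍₂₎r₍₂₎)(n₍₂₎)`. -/
def MeasCocycle2 (μ : T ⊗[k] N →ₗ[k] N) (f : (T ⊗[k] T) ⊗[k] N →ₗ[k] A) : Prop :=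
  conv (C := ((T ⊗[k] T) ⊗[k] T) ⊗[k] N)
       (f ∘ₗ (LinearMap.lTensor (T ⊗[k] T) μ
          ∘ₗ (TensorProduct.assoc k (T ⊗[k] T) T N).toLinearMap :
            ((T ⊗[k] T) ⊗[k] T) ⊗[k] N →ₗ[k] (T ⊗[k] T) ⊗[k] N))
       (f ∘ₗ LinearMap.rTensor N (LinearMap.rTensor T (LinearMap.mul' k T)))
    = conv (C := ((T ⊗[k] T) ⊗[k] T) ⊗[k] N)
           (f ∘ₗ LinearMap.rTensor N (LinearMap.rTensor T (dropL T T)))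
           (f ∘ₗ LinearMap.rTensor N
              ((LinearMap.lTensor T (LinearMap.mul' k T)
                ∘ₗ (TensorProduct.assoc k T T T).toLinearMap :
                  (T ⊗[k] T) ⊗[k] T →ₗ[k] T ⊗[k] T)))

/-- Measuring 2-cocycles. -/
def IsMeasZ2 (μ : T ⊗[k] N →ₗ[k] N) (f : (T ⊗[k] T) ⊗[k] N →ₗ[k] A) : Prop :=
  IsRegMeas2 f ∧ MeasCocycle2 μ f

/-- The measuring coboundary
`(t ⊗ s ⊗ n) ↦ ∑ g(s₍₁₎)(n₍₁₎) g⁻¹(t₍₁₎s₍₂₎)(n₍₂₎) g(t₍₂₎)(s₍₃₎(n₍₃₎))`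
of a 1-cochain `g` with convolution inverse `ginv`.  (For a 2-cocycle `f` on `N` with
stability witness `g`, this same formula is the map `d`. ) -/
noncomputable def measCobound (μ : T ⊗[k] N →ₗ[k] N) (g ginv : T ⊗[k] N →ₗ[k] A) :
    (T ⊗[k] T) ⊗[k] N →ₗ[k] A :=
  conv (g ∘ₗ LinearMap.rTensor N (dropL T T))
    (conv (ginv ∘ₗ LinearMap.rTensor N (LinearMap.mul' k T))
          (g ∘ₗ LinearMap.lTensor T μ ∘ₗ (TensorProduct.assoc k T T N).toLinearMap))

/-- Measuring 2-coboundaries. -/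
def IsMeasB2 (μ : T ⊗[k] N →ₗ[k] N) (f : (T ⊗[k] T) ⊗[k] N →ₗ[k] A) : Prop :=
  ∃ g ginv : T ⊗[k] N →ₗ[k] A, IsRegMeas1 g ∧ IsConvInv g ginv ∧ f = measCobound μ g ginv

/-- Cohomologous measuring 2-cochains. -/
def MeasCohomologous2 (μ : T ⊗[k] N →ₗ[k] N) (f f' : (T ⊗[k] T) ⊗[k] N →ₗ[k] A) : Prop :=
  ∃ b, IsMeasB2 μ b ∧ f = conv f' b

/-- `∑ f(n₍₁₎ ⊗ n'₍₁₎) f⁻¹(t₍₁₎(n₍₂₎) ⊗ t₍₂₎(n'₍₂₎))` as a map `T ⊗ (N ⊗ N) → A`. -/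
noncomputable def stabLHS (μ : T ⊗[k] N →ₗ[k] N) (f finv : N ⊗[k] N →ₗ[k] A) :
    T ⊗[k] (N ⊗[k] N) →ₗ[k] A :=
  conv (f ∘ₗ dropL T (N ⊗[k] N))
       (finv ∘ₗ TensorProduct.map μ μ
          ∘ₗ (TensorProduct.tensorTensorTensorComm k T T N N).toLinearMap
          ∘ₗ LinearMap.rTensor (N ⊗[k] N) Coalgebra.comul)

/-- `∑ g(t₍₁₎ ⊗ n₍₁₎) g⁻¹(t₍₂₎ ⊗ n₍₂₎n'₍₁₎) g(t₍₃₎ ⊗ n'₍₂₎)` as a map `T ⊗ (N ⊗ N) → A`. -/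
noncomputable def stabRHS (g ginv : T ⊗[k] N →ₗ[k] A) : T ⊗[k] (N ⊗[k] N) →ₗ[k] A :=
  conv (g ∘ₗ LinearMap.lTensor T (dropR N N))
    (conv (ginv ∘ₗ LinearMap.lTensor T (LinearMap.mul' k N))
          (g ∘ₗ LinearMap.lTensor T (dropL N N)))

/-- `g` (with convolution inverse `ginv`) witnesses the `T`-stability of the
2-cochain `f` on `N` (with convolution inverse `finv`):
`f * (f⁻¹)ᵗ = δ'(g(t ⊗ _))`. -/
def IsStabilityWitness (μ : T ⊗[k] N →ₗ[k] N) (f finv : N ⊗[k] N →ₗ[k] A)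
    (g ginv : T ⊗[k] N →ₗ[k] A) : Prop :=
  MeasNormalized1 g ∧ (∀ t : T, g (t ⊗ₜ[k] (1 : N)) = algebraMap k A (Coalgebra.counit t))
    ∧ IsConvInv g ginv ∧ stabLHS μ f finv = stabRHS g ginv

/-- The cohomology class of the 2-cocycle `f` on `N` is `T`-stable. -/
def IsTStable (μ : T ⊗[k] N →ₗ[k] N) (f finv : N ⊗[k] N →ₗ[k] A) : Prop :=
  ∃ g ginv, IsStabilityWitness μ f finv g ginv

end MeasCohomology

section SmashStatements

variable {k : Type} [Field k]
variable {T N H A : Type} [Ring T] [Bialgebra k T] [Ring N] [Bialgebra k N]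
  [Ring H] [Bialgebra k H] [CommRing A] [Algebra k A]

/-- `n ⊗ t ↦ (n ⋊ 1)(1 ⋊ t) = n ⋊ t`. -/
noncomputable def smashMul (iN : N →ₐc[k] H) (iT : T →ₐc[k] H) : N ⊗[k] T →ₗ[k] H :=
  LinearMap.mul' k H ∘ₗ TensorProduct.map iN.toLinearMap iT.toLinearMap

/-- The restriction of a 2-cochain on `H` to `N ⊗ N`. -/
noncomputable def resNN (iN : N →ₐc[k] H) (f : H ⊗[k] H →ₗ[k] A) : N ⊗[k] N →ₗ[k] A :=
  f ∘ₗ TensorProduct.map iN.toLinearMap iN.toLinearMap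

/-- The restriction of a 2-cochain on `H` to `T ⊗ T`. -/
noncomputable def resTT (iT : T →ₐc[k] H) (f : H ⊗[k] H →ₗ[k] A) : T ⊗[k] T →ₗ[k] A :=
  f ∘ₗ TensorProduct.map iT.toLinearMap iT.toLinearMap

/-- The restriction of a 2-cochain on `H` to `T ⊗ N`. -/
noncomputable def resTN (iN : N →ₐc[k] H) (iT : T →ₐc[k] H) (f : H ⊗[k] H →ₗ[k] A) :
    T ⊗[k] N →ₗ[k] A :=
  f ∘ₗ TensorProduct.map iT.toLinearMap iN.toLinearMap

/-- `f` is trivial on `N ⊗ T`: `f(n ⊗ t) = ε(n)ε(t)1`. -/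
def TrivialOnNT (iN : N →ₐc[k] H) (iT : T →ₐc[k] H) (f : H ⊗[k] H →ₗ[k] A) : Prop :=
  ∀ (n : N) (t : T), f (iN n ⊗ₜ[k] iT t)
    = algebraMap k A (Coalgebra.counit n * Coalgebra.counit t)

/-- `f` is trivial on `T ⊗ T`. -/
def TrivialOnTT (iT : T →ₐc[k] H) (f : H ⊗[k] H →ₗ[k] A) : Prop :=
  ∀ t t' : T, f (iT t ⊗ₜ[k] iT t')
    = algebraMap k A (Coalgebra.counit t * Coalgebra.counit t')

/-- `F` is the 2-cochain `ι f : (n ⋊ t) ⊗ (n' ⋊ t') ↦ ε(n) f(t)(n') ε(t')` on `H`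
associated with a measuring 1-cochain `f`. -/
def IotaOf (iN : N →ₐc[k] H) (iT : T →ₐc[k] H) (f : T ⊗[k] N →ₗ[k] A)
    (F : H ⊗[k] H →ₗ[k] A) : Prop :=
  ∀ (n : N) (t : T) (n' : N) (t' : T),
    F ((iN n * iT t) ⊗ₜ[k] (iN n' * iT t'))
      = algebraMap k A (Coalgebra.counit n * Coalgebra.counit t') * f (t ⊗ₜ[k] n')

/-- `J` is the 3-cochain
`jf : (n⋊t) ⊗ (n'⋊t') ⊗ (n''⋊t'') ↦ ε(n)ε(n') f(t⊗t')(n'') ε(t'')` on `H`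
associated with a measuring 2-cochain `f`. -/
def JOf (iN : N →ₐc[k] H) (iT : T →ₐc[k] H) (f : (T ⊗[k] T) ⊗[k] N →ₗ[k] A)
    (J : (H ⊗[k] H) ⊗[k] H →ₗ[k] A) : Prop :=
  ∀ (n : N) (t : T) (n' : N) (t' : T) (n'' : N) (t'' : T),
    J (((iN n * iT t) ⊗ₜ[k] (iN n' * iT t')) ⊗ₜ[k] (iN n'' * iT t''))
      = algebraMap k A (Coalgebra.counit n * Coalgebra.counit n' * Coalgebra.counit t'')
          * f ((t ⊗ₜ[k] t') ⊗ₜ[k] n'')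

end SmashStatements

end SmashPaper

open TensorProduct SmashPaper

namespace SmashPaper

section MonoidLevel

/-- A monoid `G` with unique factorization `G = N · T`, where `T` acts on `N` by monoid
endomorphisms and `t n = t(n) t`. -/
structure SmashMonoid (N T G : Type*) [Monoid N] [Monoid T] [Monoid G] where
  act : T → N → N
  one_act : ∀ n, act 1 n = n
  mul_act : ∀ t s n, act (t * s) n = act t (act s n)
  act_one : ∀ t, act t 1 = 1
  act_mul : ∀ t n n', act t (n * n') = act t n * act t n'
  iN : N →* G
  iT : T →* G
  pN : G → N
  pT : G → T
  straighten : ∀ t n, iT t * iN n = iN (act t n) * iT t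
  recompose : ∀ x, iN (pN x) * iT (pT x) = x
  pN_apply : ∀ n t, pN (iN n * iT t) = n
  pT_apply : ∀ n t, pT (iN n * iT t) = t

variable {N T G M : Type*} [Monoid N] [Monoid T] [Monoid G] [AddCommGroup M]

/-- Normalized 2-cocycles on a monoid with trivial coefficients. -/
structure Cocycle2 (f : G → G → M) : Prop where
  one_left : ∀ x, f 1 x = 0
  one_right : ∀ x, f x 1 = 0
  cocycle : ∀ x y z, f x y + f (x * y) z = f y z + f x (y * z)

/-- Normalized 3-cocycles on a monoid with trivial coefficients. -/
structure Cocycle3 (f : G → G → G → M) : Prop where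
  one_left : ∀ x y, f 1 x y = 0
  one_mid : ∀ x y, f x 1 y = 0
  one_right : ∀ x y, f x y 1 = 0
  cocycle : ∀ x y z w,
    f y z w + (f x (y * z) w + f x y z) = f (x * y) z w + f x y (z * w)

/-- `f c` is additive on `N` for every `c`. -/
structure AddMeasures {C : Type*} (f : C → N → M) : Prop where
  map_mul : ∀ c n n', f c (n * n') = f c n + f c n'
  map_one : ∀ c, f c 1 = 0

namespace SmashMonoid

variable (S : SmashMonoid N T G)

lemma mul_eq (x y : G) :
    x * y = S.iN (S.pN x * S.act (S.pT x) (S.pN y)) * S.iT (S.pT x * S.pT y) := by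
  conv_lhs => rw [← S.recompose x, ← S.recompose y]
  rw [map_mul, map_mul, mul_assoc, ← mul_assoc (S.iT _) (S.iN _), S.straighten]
  simp only [mul_assoc]

lemma pN_mul (x y : G) : S.pN (x * y) = S.pN x * S.act (S.pT x) (S.pN y) := by
  rw [S.mul_eq, S.pN_apply]

lemma pT_mul (x y : G) : S.pT (x * y) = S.pT x * S.pT y := by
  rw [S.mul_eq, S.pT_apply]

@[simp] lemma pN_iN (n : N) : S.pN (S.iN n) = n := by simpa using S.pN_apply n 1
@[simp] lemma pT_iN (n : N) : S.pT (S.iN n) = 1 := by simpa using S.pT_apply n 1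
@[simp] lemma pN_iT (t : T) : S.pN (S.iT t) = 1 := by simpa using S.pN_apply 1 t
@[simp] lemma pT_iT (t : T) : S.pT (S.iT t) = t := by simpa using S.pT_apply 1 t
@[simp] lemma pN_one : S.pN 1 = 1 := by simpa using S.pN_iN 1
@[simp] lemma pT_one : S.pT 1 = 1 := by simpa using S.pT_iN 1

/-- `g` witnesses the `T`-stability of the 2-cochain `f` on `N`. -/
structure Witness (f : N → N → M) (g : T → N → M) : Prop where
  one_left : ∀ n, g 1 n = 0
  one_right : ∀ t, g t 1 = 0
  stab : ∀ t n n', f n n' - f (S.act t n) (S.act t n') = g t n - g t (n * n') + g t n'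

/-- The measuring coboundary of a 1-cochain. -/
def delta (g : T → N → M) (t s : T) (n : N) : M := g s n - g (t * s) n + g t (S.act s n)

/-- Normalized measuring 2-cocycles. -/
structure MeasCocycle (f : T → T → N → M) : Prop where
  meas : ∀ t s, (∀ n n', f t s (n * n') = f t s n + f t s n') ∧ f t s 1 = 0
  one_left : ∀ t n, f 1 t n = 0
  one_right : ∀ t n, f t 1 n = 0
  cocycle : ∀ t s r n, f t s (S.act r n) + f (t * s) r n = f s r n + f t (s * r) n

variable {S}

lemma Witness.sub {f f' : N → N → M} {g g' : T → N → M}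
    (h : S.Witness f g) (h' : S.Witness f' g') :
    S.Witness (fun n n' => f n n' - f' n n') (fun t n => g t n - g' t n) where
  one_left n := by simp [h.one_left, h'.one_left]
  one_right n := by simp [h.one_right, h'.one_right]
  stab t n n' := by
    linear_combination (norm := module) h.stab t n n' - h'.stab t n n'

lemma Witness.delta_isMeasCocycle {f : N → N → M} {g : T → N → M} (h : S.Witness f g) :
    S.MeasCocycle (S.delta g) where
  meas t s := by
    refine ⟨fun n n' => ?_, by simp [delta, h.one_right, S.act_one]⟩
    have h1 := h.stab s n n'
    have h2 := h.stab (t * s) n n'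
    have h3 := h.stab t (S.act s n) (S.act s n')
    simp only [delta, S.act_mul, S.mul_act] at *
    linear_combination (norm := module) h1 - h2 + h3
  one_left t n := by simp [delta, h.one_left]
  one_right t n := by simp [delta, h.one_left, S.one_act]
  cocycle t s r n := by
    simp only [delta, S.mul_act, mul_assoc]
    module

lemma witness_of_cobound (τ : N → M) :
    S.Witness (fun n n' => τ n' - τ (n * n') + τ n) (fun t n => τ n - τ (S.act t n)) where
  one_left n := by simp [S.one_act]
  one_right n := by simp [S.act_one]
  stab t n n' := by simp only [S.act_mul]; module

lemma delta_cobound (τ : N → M) (t s : T) (n : N) :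
    S.delta (fun t n => τ n - τ (S.act t n)) t s n = 0 := by
  simp only [delta, S.mul_act]; module

lemma Witness.measures {g : T → N → M} (h : S.Witness (fun _ _ => 0) g) : AddMeasures g where
  map_mul t n n' := by linear_combination (norm := module) h.stab t n n'
  map_one := h.one_right

lemma witness_zero {g : T → N → M} (h : AddMeasures g) (h1 : ∀ n, g 1 n = 0) :
    S.Witness (fun _ _ => 0) g where
  one_left := h1
  one_right := h.map_one
  stab t n n' := by rw [h.map_mul]; module

/-- The witness attached to the restriction to `N` of a cocycle on `G`. -/
lemma witness_of_cocycle {F : G → G → M} (h : Cocycle2 F) :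
    S.Witness (fun n n' => F (S.iN n) (S.iN n'))
      (fun t n => F (S.iT t) (S.iN n) - F (S.iN (S.act t n)) (S.iT t)) where
  one_left n := by simp [h.one_left, h.one_right]
  one_right t := by simp [h.one_left, h.one_right, S.act_one]
  stab t n n' := by
    have h1 := h.cocycle (S.iT t) (S.iN n) (S.iN n')
    have h2 := h.cocycle (S.iN (S.act t n)) (S.iT t) (S.iN n')
    have h3 := h.cocycle (S.iN (S.act t n)) (S.iN (S.act t n')) (S.iT t)
    simp only [S.act_mul, S.straighten, ← map_mul] at *
    linear_combination (norm := module) - h1 + h2 - h3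

/-- The coboundary of the 2-cochain on `G` built from a cocycle on `N` and a witness. -/
lemma cobound_glue {f : N → N → M} {g : T → N → M} (hf : Cocycle2 f) (h : S.Witness f g)
    {F : G → G → M} (hF : ∀ x y, F x y = f (S.pN x) (S.act (S.pT x) (S.pN y))
      + g (S.pT x) (S.pN y)) (x y z : G) :
    F y z - F (x * y) z + F x (y * z) - F x y = S.delta g (S.pT x) (S.pT y) (S.pN z) := by
  have h1 := hf.cocycle (S.pN x) (S.act (S.pT x) (S.pN y))
    (S.act (S.pT x * S.pT y) (S.pN z))
  have h2 := h.stab (S.pT x) (S.pN y) (S.act (S.pT y) (S.pN z))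
  simp only [hF, S.pN_mul, S.pT_mul, delta, S.mul_act, S.act_mul] at *
  linear_combination (norm := module) h2 - h1

lemma glue_one {f : N → N → M} {g : T → N → M} (hf : Cocycle2 f) (h : S.Witness f g)
    {F : G → G → M} (hF : ∀ x y, F x y = f (S.pN x) (S.act (S.pT x) (S.pN y))
      + g (S.pT x) (S.pN y)) (x : G) : F 1 x = 0 ∧ F x 1 = 0 := by
  simp [hF, hf.one_left, hf.one_right, h.one_left, h.one_right, S.act_one]

lemma glue_cocycle {f : N → N → M} {g : T → N → M} (hf : Cocycle2 f) (h : S.Witness f g)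
    (hd : ∀ t s n, S.delta g t s n = 0)
    {F : G → G → M} (hF : ∀ x y, F x y = f (S.pN x) (S.act (S.pT x) (S.pN y))
      + g (S.pT x) (S.pN y)) : Cocycle2 F where
  one_left x := (glue_one hf h hF x).1
  one_right x := (glue_one hf h hF x).2
  cocycle x y z := by
    have := cobound_glue hf h hF x y z
    rw [hd] at this
    linear_combination (norm := module) - this

/-- A 2-cocycle on `G` that is trivial on `N × T` and on `T × T` is determined by its
restrictions to `N × N` and `T × N`. -/
lemma cocycle_eq {F : G → G → M} (h : Cocycle2 F) (hNT : ∀ n t, F (S.iN n) (S.iT t) = 0)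
    (hTT : ∀ s t, F (S.iT s) (S.iT t) = 0) (x y : G) :
    F x y = F (S.iN (S.pN x)) (S.iN (S.act (S.pT x) (S.pN y)))
      + F (S.iT (S.pT x)) (S.iN (S.pN y)) := by
  set n := S.pN x
  set t := S.pT x
  set n' := S.pN y
  set t' := S.pT y
  have h1 := h.cocycle (S.iN n) (S.iT t) y
  have h2 := h.cocycle (S.iN n) (S.iN (S.act t n')) (S.iT (t * t'))
  have h3 := h.cocycle (S.iT t) (S.iN n') (S.iT t')
  have h4 := h.cocycle (S.iN (S.act t n')) (S.iT t) (S.iT t')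
  have e : S.iT t * y = S.iN (S.act t n') * S.iT (t * t') := by
    rw [← S.recompose y, ← mul_assoc, S.straighten, mul_assoc, map_mul]
  rw [S.recompose x, e] at h1
  rw [S.recompose y, S.straighten] at h3
  rw [← map_mul] at h2 h4
  simp only [hNT, hTT] at h1 h2 h3 h4
  linear_combination (norm := module) h1 - h2 - h3 + h4

lemma delta_eq_zero_of_cocycle {F : G → G → M} (h : Cocycle2 F)
    (hNT : ∀ n t, F (S.iN n) (S.iT t) = 0) (hTT : ∀ s t, F (S.iT s) (S.iT t) = 0)
    (t s : T) (n : N) : S.delta (fun t n => F (S.iT t) (S.iN n)) t s n = 0 := by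
  have h1 := h.cocycle (S.iT t) (S.iT s) (S.iN n)
  have e := cocycle_eq h hNT hTT (S.iT t) (S.iT s * S.iN n)
  simp only [S.pN_iT, map_one, h.one_left, S.pT_iT, S.pN_mul, one_mul, zero_add, S.pN_iN] at e
  rw [e, hTT, ← map_mul] at h1
  simp only [delta]
  linear_combination (norm := module) - h1

lemma adjust_cocycle {F F₁ : G → G → M} (hF : Cocycle2 F) {τ : G → M} (h1 : τ 1 = 0)
    (hF₁ : ∀ x y, F₁ x y = F x y - (τ y - τ (x * y) + τ x)) : Cocycle2 F₁ where
  one_left x := by simp [hF₁, hF.one_left, h1]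
  one_right x := by simp [hF₁, hF.one_right, h1]
  cocycle x y z := by
    simp only [hF₁, mul_assoc]
    linear_combination (norm := module) hF.cocycle x y z

lemma adjust_apply {F F₁ : G → G → M} (hF : Cocycle2 F) {f : N → N → M} {τN : N → M}
    {τT : T → M} (hN1 : τN 1 = 0) (hT1 : τT 1 = 0)
    (hN : ∀ n n', F (S.iN n) (S.iN n') = f n n' + (τN n' - τN (n * n') + τN n))
    (hT : ∀ t t', F (S.iT t) (S.iT t') = τT t' - τT (t * t') + τT t)
    {τ : G → M} (hτ : ∀ x, τ x = τN (S.pN x) + τT (S.pT x) - F (S.iN (S.pN x)) (S.iT (S.pT x)))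
    (hF₁ : ∀ x y, F₁ x y = F x y - (τ y - τ (x * y) + τ x)) :
    (∀ n n', F₁ (S.iN n) (S.iN n') = f n n') ∧ (∀ n t, F₁ (S.iN n) (S.iT t) = 0) ∧
      (∀ s t, F₁ (S.iT s) (S.iT t) = 0) := by
  refine ⟨fun n n' => ?_, fun n t => ?_, fun s t => ?_⟩
  · simp only [hF₁, hN]; simp only [← map_mul, hτ]; simp [-map_mul, hF.one_right, hT1]
  · simp only [hF₁, hτ, S.pN_apply, S.pT_apply]
    simp only [pN_iT, pT_iT, hN1, pN_iN, pT_iN, hT1, map_one, hF.one_left, hF.one_right]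
    module
  · simp only [hF₁, hT]; simp only [← map_mul, hτ]; simp [-map_mul, hF.one_left, hN1]

lemma cocycle3_of_measCocycle {f : T → T → N → M} (h : S.MeasCocycle f) :
    Cocycle3 fun x y z => f (S.pT x) (S.pT y) (S.pN z) where
  one_left x y := by simp [h.one_left]
  one_mid x y := by simp [h.one_right]
  one_right x y := by simp [(h.meas _ _).2]
  cocycle x y z w := by
    simp only [S.pT_mul, S.pN_mul, (h.meas _ _).1]
    linear_combination (norm := module) - h.cocycle (S.pT x) (S.pT y) (S.pT z) (S.pN w)

/-- A 2-cochain whose coboundary is the inflation of a measuring cocycle `f` restricts to a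
cocycle on `N`, and yields a witness with `delta` equal to `f`. -/
lemma of_cobound_eq {f : T → T → N → M} (hf : S.MeasCocycle f) {v : G → G → M}
    (hl : ∀ x, v 1 x = 0) (hr : ∀ x, v x 1 = 0)
    (h : ∀ x y z, f (S.pT x) (S.pT y) (S.pN z) = v y z - v (x * y) z + v x (y * z) - v x y) :
    Cocycle2 (fun n n' => v (S.iN n) (S.iN n')) ∧
    S.Witness (fun n n' => v (S.iN n) (S.iN n'))
      (fun t n => v (S.iT t) (S.iN n) - v (S.iN (S.act t n)) (S.iT t)) ∧
    ∀ t s n, f t s n =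
      S.delta (fun t n => v (S.iT t) (S.iN n) - v (S.iN (S.act t n)) (S.iT t)) t s n := by
  refine ⟨⟨fun n => ?_, fun n => ?_, fun n n' n'' => ?_⟩, ⟨fun n => ?_, fun t => ?_,
    fun t n n' => ?_⟩, fun t s n => ?_⟩
  · simp [hl]
  · simp [hr]
  · have := h (S.iN n) (S.iN n') (S.iN n'')
    simp only [S.pT_iN, hf.one_left] at this
    simp only [map_mul]
    linear_combination (norm := module) this
  · simp [hl, hr]
  · simp [hl, hr, S.act_one]
  · have h1 := h (S.iT t) (S.iN n) (S.iN n')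
    have h2 := h (S.iN (S.act t n)) (S.iT t) (S.iN n')
    have h3 := h (S.iN (S.act t n)) (S.iN (S.act t n')) (S.iT t)
    simp only [S.act_mul, S.straighten, ← map_mul, S.pT_iN, S.pT_iT, S.pN_iT,
      hf.one_left, hf.one_right] at *
    linear_combination (norm := module) - h1 + h2 - h3
  · have h1 := h (S.iT t) (S.iT s) (S.iN n)
    have h2 := h (S.iT t) (S.iN (S.act s n)) (S.iT s)
    have h3 := h (S.iN (S.act t (S.act s n))) (S.iT t) (S.iT s)
    simp only [delta, S.mul_act, S.straighten, ← map_mul, S.pT_iN, S.pT_iT, S.pN_iT, S.pN_iN,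
      hf.one_left, hf.one_right] at *
    linear_combination (norm := module) h1 - h2 + h3

/-- If the inflation of a measuring 1-cochain is a coboundary, it is a measuring coboundary. -/
lemma of_inflation_eq_cobound {f : T → N → M} (hf : ∀ n, f 1 n = 0) {τ : G → M}
    (h : ∀ x y, f (S.pT x) (S.pN y) = τ y - τ (x * y) + τ x) :
    (∀ n n', τ (S.iN (n * n')) = τ (S.iN n) + τ (S.iN n')) ∧
      ∀ t n, f t n = τ (S.iN n) - τ (S.iN (S.act t n)) := by
  refine ⟨fun n n' => ?_, fun t n => ?_⟩
  · have := h (S.iN n) (S.iN n')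
    simp only [S.pT_iN, hf, ← map_mul] at this
    linear_combination (norm := module) this
  · have h2 := h (S.iT t) (S.iN n)
    have h3 := h (S.iN (S.act t n)) (S.iT t)
    simp only [S.pT_iN, S.pT_iT, S.pN_iN, hf, S.straighten] at h2 h3
    linear_combination (norm := module) h2 - h3

end SmashMonoid

end MonoidLevel

section Points

variable {k : Type} [Field k]
variable {B C D E G : Type} [AddCommGroup B] [Module k B] [Coalgebra k B]
  [AddCommGroup C] [Module k C] [Coalgebra k C]
  [AddCommGroup D] [Module k D] [Coalgebra k D] [AddCommGroup E] [Module k E] [Coalgebra k E]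
  [AddCommGroup G] [Module k G] [Coalgebra k G]
variable {H : Type} [Ring H] [Bialgebra k H] {A : Type} [CommRing A] [Algebra k A]

variable (k C D) in
/-- The `C`-valued points of the coalgebra `D`: coalgebra maps `C → D`. -/
@[ext] structure Point where
  hom : C →ₗc[k] D

/-- `c ↦ ∑ p(c₍₁₎) ⊗ q(c₍₂₎)`. -/
noncomputable def pairL {P Q : Type} [AddCommGroup P] [Module k P] [AddCommGroup Q] [Module k Q]
    (p : C →ₗ[k] P) (q : C →ₗ[k] Q) : C →ₗ[k] P ⊗[k] Q :=
  TensorProduct.map p q ∘ₗ Coalgebra.comul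

namespace Point

/-- The underlying linear map of a point. -/
def lin (x : Point k C D) : C →ₗ[k] D := x.hom

lemma lin_injective : Function.Injective (lin : Point k C D → _) := fun _ _ h =>
  Point.ext (CoalgHom.coe_linearMap_injective h)

@[simp] lemma counit_comp_lin (x : Point k C D) :
    Coalgebra.counit ∘ₗ x.lin = Coalgebra.counit (R := k) := x.hom.counit_comp

lemma comul_comp_lin (x : Point k C D) : Coalgebra.comul ∘ₗ x.lin = pairL x.lin x.lin :=
  x.hom.map_comp_comul.symm

/-- Composition of points. -/
def comp (y : Point k D E) (x : Point k C D) : Point k C E := ⟨y.hom.comp x.hom⟩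

@[simp] lemma comp_lin (y : Point k D E) (x : Point k C D) :
    (y.comp x).lin = y.lin ∘ₗ x.lin := rfl

@[simp] lemma comp_comp (z : Point k E G) (y : Point k D E) (x : Point k C D) :
    (z.comp y).comp x = z.comp (y.comp x) := rfl

variable (k C) in
/-- The universal point. -/
protected def id : Point k C C := ⟨CoalgHom.id k C⟩

@[simp] lemma id_lin : (Point.id k C).lin = LinearMap.id := rfl

@[simp] lemma id_comp (x : Point k C D) : (Point.id k D).comp x = x := rfl
@[simp] lemma comp_id (x : Point k C D) : x.comp (Point.id k C) = x := rfl

section Pair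

variable [Coalgebra.IsCocomm k C] [Coalgebra.IsCocomm k B]

/-- The point of a tensor product with given components. -/
noncomputable def pair (x : Point k C D) (y : Point k C E) : Point k C (D ⊗[k] E) :=
  ⟨(Coalgebra.TensorProduct.map x.hom y.hom).comp (Coalgebra.comulCoalgHom k C)⟩

@[simp] lemma pair_lin (x : Point k C D) (y : Point k C E) :
    (pair x y).lin = pairL x.lin y.lin := rfl

@[simp] lemma pair_comp (x : Point k C D) (y : Point k C E) (q : Point k B C) :
    (pair x y).comp q = pair (x.comp q) (y.comp q) := by
  apply lin_injective
  simp only [comp_lin, pair_lin]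
  rw [pairL, pairL, LinearMap.comp_assoc, comul_comp_lin, pairL, ← LinearMap.comp_assoc,
    ← TensorProduct.map_comp]

end Pair

end Point

section Linear

variable {P Q R S : Type} [AddCommGroup P] [Module k P] [AddCommGroup Q] [Module k Q]
  [AddCommGroup R] [Module k R] [AddCommGroup S] [Module k S]

@[simp] lemma map_pairL (f : P →ₗ[k] R) (g : Q →ₗ[k] S) (p : C →ₗ[k] P) (q : C →ₗ[k] Q) :
    TensorProduct.map f g ∘ₗ pairL p q = pairL (f ∘ₗ p) (g ∘ₗ q) := by
  rw [pairL, pairL, ← LinearMap.comp_assoc, ← TensorProduct.map_comp]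

@[simp] lemma rTensor_pairL (f : P →ₗ[k] R) (p : C →ₗ[k] P) (q : C →ₗ[k] Q) :
    LinearMap.rTensor Q f ∘ₗ pairL p q = pairL (f ∘ₗ p) q := map_pairL f LinearMap.id p q

@[simp] lemma lTensor_pairL (g : Q →ₗ[k] S) (p : C →ₗ[k] P) (q : C →ₗ[k] Q) :
    LinearMap.lTensor P g ∘ₗ pairL p q = pairL p (g ∘ₗ q) := map_pairL LinearMap.id g p q

@[simp] lemma assoc_pairL (p : C →ₗ[k] P) (q : C →ₗ[k] Q) (r : C →ₗ[k] R) :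
    (TensorProduct.assoc k P Q R).toLinearMap ∘ₗ pairL (pairL p q) r = pairL p (pairL q r) := by
  have h : (TensorProduct.assoc k P Q R).toLinearMap ∘ₗ
      TensorProduct.map (TensorProduct.map p q) r =
      TensorProduct.map p (TensorProduct.map q r) ∘ₗ (TensorProduct.assoc k C C C).toLinearMap := by
    ext; rfl
  have e1 : pairL (pairL p q) r = TensorProduct.map (TensorProduct.map p q) r ∘ₗ
      LinearMap.rTensor C Coalgebra.comul ∘ₗ Coalgebra.comul := by
    rw [pairL, pairL, ← LinearMap.comp_assoc, LinearMap.map_comp_rTensor]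
  have e2 : pairL p (pairL q r) = TensorProduct.map p (TensorProduct.map q r) ∘ₗ
      LinearMap.lTensor C Coalgebra.comul ∘ₗ Coalgebra.comul := by
    rw [pairL, pairL, ← LinearMap.comp_assoc, LinearMap.map_comp_lTensor]
  rw [e1, e2, ← LinearMap.comp_assoc, h, LinearMap.comp_assoc, Coalgebra.coassoc]

@[simp] lemma dropL_pairL (p : C →ₗ[k] D) (hp : Coalgebra.counit (R := k) ∘ₗ p = Coalgebra.counit)
    (q : C →ₗ[k] Q) : dropL D Q ∘ₗ pairL p q = q := by
  rw [dropL, LinearMap.comp_assoc, rTensor_pairL, hp]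
  have : pairL (Coalgebra.counit (R := k)) q = LinearMap.lTensor k q ∘ₗ
      LinearMap.rTensor C Coalgebra.counit ∘ₗ (Coalgebra.comul : C →ₗ[k] C ⊗[k] C) := by
    rw [pairL, ← LinearMap.comp_assoc, LinearMap.lTensor_comp_rTensor]
  rw [this, Coalgebra.rTensor_counit_comp_comul]
  ext; simp

@[simp] lemma dropR_pairL (q : C →ₗ[k] Q) (p : C →ₗ[k] D)
    (hp : Coalgebra.counit (R := k) ∘ₗ p = Coalgebra.counit) : dropR Q D ∘ₗ pairL q p = q := by
  rw [dropR, LinearMap.comp_assoc, lTensor_pairL, hp]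
  have : pairL q (Coalgebra.counit (R := k)) = LinearMap.rTensor k q ∘ₗ
      LinearMap.lTensor C Coalgebra.counit ∘ₗ (Coalgebra.comul : C →ₗ[k] C ⊗[k] C) := by
    rw [pairL, ← LinearMap.comp_assoc, LinearMap.rTensor_comp_lTensor]
  rw [this, Coalgebra.lTensor_counit_comp_comul]
  ext; simp

lemma comul_comul_comm [Coalgebra.IsCocomm k C] :
    (TensorProduct.tensorTensorTensorComm k C C C C).toLinearMap ∘ₗ
      pairL (Coalgebra.comul (R := k) (A := C)) Coalgebra.comul =
      pairL (Coalgebra.comul (R := k) (A := C)) Coalgebra.comul := by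
  have h := (Coalgebra.comulCoalgHom k C).map_comp_comul
  exact h.symm

@[simp] lemma tensorTensorTensorComm_pairL [Coalgebra.IsCocomm k C] (p : C →ₗ[k] P)
    (q : C →ₗ[k] Q) (r : C →ₗ[k] R) (s : C →ₗ[k] S) :
    (TensorProduct.tensorTensorTensorComm k P Q R S).toLinearMap ∘ₗ pairL (pairL p q) (pairL r s)
      = pairL (pairL p r) (pairL q s) := by
  have h : (TensorProduct.tensorTensorTensorComm k P Q R S).toLinearMap ∘ₗ
      TensorProduct.map (TensorProduct.map p q) (TensorProduct.map r s) =
      TensorProduct.map (TensorProduct.map p r) (TensorProduct.map q s) ∘ₗ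
        (TensorProduct.tensorTensorTensorComm k C C C C).toLinearMap := by
    ext; rfl
  have e (p : C →ₗ[k] P) (q : C →ₗ[k] Q) (r : C →ₗ[k] R) (s : C →ₗ[k] S) :
      pairL (pairL p q) (pairL r s) =
      TensorProduct.map (TensorProduct.map p q) (TensorProduct.map r s) ∘ₗ
        pairL Coalgebra.comul Coalgebra.comul := (map_pairL _ _ _ _).symm
  have e' : pairL (pairL p r) (pairL q s) =
      TensorProduct.map (TensorProduct.map p r) (TensorProduct.map q s) ∘ₗ
        pairL Coalgebra.comul Coalgebra.comul := (map_pairL _ _ _ _).symm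
  rw [e, e', ← LinearMap.comp_assoc, h, LinearMap.comp_assoc, comul_comul_comm]

lemma conv_eq_pairL (f g : C →ₗ[k] A) : conv f g = LinearMap.mul' k A ∘ₗ pairL f g := rfl

lemma conv_comp_lin (f g : D →ₗ[k] A) (x : Point k C D) :
    conv f g ∘ₗ x.lin = conv (f ∘ₗ x.lin) (g ∘ₗ x.lin) := by
  rw [conv_eq_pairL, conv_eq_pairL, ← map_pairL, ← Point.comul_comp_lin]; rfl

lemma convOne_comp_lin (x : Point k C D) : convOne D A ∘ₗ x.lin = convOne (k := k) C A := by
  rw [convOne, convOne, LinearMap.comp_assoc, x.counit_comp_lin]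

end Linear

namespace Point

/-- The first projection, as a point. -/
noncomputable def fst : Point k (D ⊗[k] E) D :=
  ⟨(Coalgebra.TensorProduct.rid k k D).toCoalgHom.comp
    (Coalgebra.TensorProduct.map (CoalgHom.id k D) (Coalgebra.counitCoalgHom k E))⟩

/-- The second projection, as a point. -/
noncomputable def snd : Point k (D ⊗[k] E) E :=
  ⟨(Coalgebra.TensorProduct.lid k E).toCoalgHom.comp
    (Coalgebra.TensorProduct.map (Coalgebra.counitCoalgHom k D) (CoalgHom.id k E))⟩

lemma fst_lin : (fst : Point k (D ⊗[k] E) D).lin = dropR D E := rfl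
lemma snd_lin : (snd : Point k (D ⊗[k] E) E).lin = dropL D E := rfl

section Pair

variable [Coalgebra.IsCocomm k C]

@[simp] lemma fst_comp_pair (x : Point k C D) (y : Point k C E) : fst.comp (pair x y) = x :=
  lin_injective (by simp [fst_lin])

@[simp] lemma snd_comp_pair (x : Point k C D) (y : Point k C E) : snd.comp (pair x y) = y :=
  lin_injective (by simp [snd_lin])

omit [Coalgebra.IsCocomm k C] in
lemma pairL_dropR_dropL : pairL (dropR D E) (dropL D E) = LinearMap.id (R := k) := by
  have h : TensorProduct.map (dropR D E) (dropL D E) ∘ₗ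
      (TensorProduct.tensorTensorTensorComm k D D E E).toLinearMap =
      TensorProduct.map (dropR D D) (dropL E E) := by
    ext a a' b b'
    simp only [TensorProduct.AlgebraTensorModule.curry_apply, LinearMap.restrictScalars_self,
      TensorProduct.curry_apply, LinearMap.coe_comp, LinearEquiv.coe_coe, Function.comp_apply,
      TensorProduct.tensorTensorTensorComm_tmul, TensorProduct.map_tmul, dropR, dropL,
      LinearMap.lTensor_tmul, LinearMap.rTensor_tmul, TensorProduct.rid_tmul,
      TensorProduct.lid_tmul, TensorProduct.smul_tmul_smul, mul_comm]
  have hD : dropR D D ∘ₗ Coalgebra.comul = LinearMap.id (R := k) := by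
    have := dropR_pairL (k := k) (LinearMap.id (M := D)) LinearMap.id rfl
    rwa [pairL, TensorProduct.map_id] at this
  have hE : dropL E E ∘ₗ Coalgebra.comul = LinearMap.id (R := k) := by
    have := dropL_pairL (k := k) (LinearMap.id (M := E)) rfl LinearMap.id
    rwa [pairL, TensorProduct.map_id] at this
  have e : pairL (dropR D E) (dropL D E) = TensorProduct.map (dropR D E) (dropL D E) ∘ₗ
      (TensorProduct.tensorTensorTensorComm k D D E E).toLinearMap ∘ₗ
      TensorProduct.map Coalgebra.comul Coalgebra.comul := rfl
  rw [e, ← LinearMap.comp_assoc, h, ← TensorProduct.map_comp, hD, hE, TensorProduct.map_id]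

omit [Coalgebra.IsCocomm k C] in
lemma pair_fst_comp_snd_comp_lin [Coalgebra.IsCocomm k D] [Coalgebra.IsCocomm k E]
    {D' E' : Type} [AddCommGroup D'] [Module k D'] [Coalgebra k D']
    [AddCommGroup E'] [Module k E'] [Coalgebra k E'] (p : Point k D D') (q : Point k E E') :
    (pair (p.comp fst) (q.comp snd)).lin = TensorProduct.map p.lin q.lin := by
  simp only [pair_lin, comp_lin, fst_lin, snd_lin]
  rw [← map_pairL, pairL_dropR_dropL]
  rfl

@[simp] lemma pair_fst_snd [Coalgebra.IsCocomm k D] [Coalgebra.IsCocomm k E] :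
    pair fst snd = Point.id k (D ⊗[k] E) := by
  apply lin_injective
  have := pair_fst_comp_snd_comp_lin (Point.id k D) (Point.id k E)
  simpa using this

lemma pair_eta [Coalgebra.IsCocomm k D] [Coalgebra.IsCocomm k E] (x : Point k C (D ⊗[k] E)) :
    pair (fst.comp x) (snd.comp x) = x := by
  rw [← pair_comp, pair_fst_snd, id_comp]

end Pair

section Monoid

noncomputable instance : One (Point k C H) where
  one := ⟨(Bialgebra.unitBialgHom k H).toCoalgHom.comp (Coalgebra.counitCoalgHom k C)⟩

lemma one_lin : (1 : Point k C H).lin = Algebra.linearMap k H ∘ₗ Coalgebra.counit := rfl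

@[simp] lemma one_comp (q : Point k B C) : (1 : Point k C H).comp q = 1 := by
  apply lin_injective
  rw [comp_lin, one_lin, LinearMap.comp_assoc, counit_comp_lin, one_lin]

variable [Coalgebra.IsCocomm k C]

noncomputable instance : Mul (Point k C H) where
  mul x y := ⟨(Bialgebra.mulCoalgHom k H).comp (pair x y).hom⟩

lemma mul_lin (x y : Point k C H) : (x * y).lin = LinearMap.mul' k H ∘ₗ pairL x.lin y.lin := rfl

noncomputable instance : Monoid (Point k C H) where
  mul_assoc x y z := lin_injective <| congrArg WithConv.ofConv
    (mul_assoc (WithConv.toConv x.lin) (WithConv.toConv y.lin) (WithConv.toConv z.lin))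
  one_mul x := lin_injective <| congrArg WithConv.ofConv (one_mul (WithConv.toConv x.lin))
  mul_one x := lin_injective <| congrArg WithConv.ofConv (mul_one (WithConv.toConv x.lin))

@[simp] lemma mul_comp [Coalgebra.IsCocomm k B] (x y : Point k C H) (q : Point k B C) :
    (x * y).comp q = x.comp q * y.comp q := by
  apply lin_injective
  have := congrArg lin (pair_comp x y q)
  simp only [comp_lin, mul_lin, pair_lin] at *
  rw [LinearMap.comp_assoc, this]

variable {H' : Type} [Ring H'] [Bialgebra k H']

/-- The point underlying a bialgebra map. -/
noncomputable def ofHom (i : H →ₐc[k] H') : Point k H H' := ⟨i⟩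

lemma ofHom_lin (i : H →ₐc[k] H') : (ofHom i).lin = i.toLinearMap := rfl

@[simp] lemma ofHom_comp_mul (i : H →ₐc[k] H') (x y : Point k C H) :
    (ofHom i).comp (x * y) = (ofHom i).comp x * (ofHom i).comp y := by
  apply lin_injective
  have h : i.toLinearMap ∘ₗ LinearMap.mul' k H =
      LinearMap.mul' k H' ∘ₗ TensorProduct.map i.toLinearMap i.toLinearMap := by
    ext x y; exact map_mul i x y
  simp only [comp_lin, mul_lin, ofHom_lin]
  rw [← LinearMap.comp_assoc, h, LinearMap.comp_assoc, map_pairL]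

omit [Coalgebra.IsCocomm k C] in
@[simp] lemma ofHom_comp_one (i : H →ₐc[k] H') :
    (ofHom i).comp (1 : Point k C H) = 1 := by
  apply lin_injective
  have h : i.toLinearMap ∘ₗ Algebra.linearMap k H = Algebra.linearMap k H' := by
    ext; exact (congrArg i (map_one (algebraMap k H))).trans
      ((map_one i).trans (map_one (algebraMap k H')).symm)
  simp only [comp_lin, one_lin, ofHom_lin]
  rw [← LinearMap.comp_assoc, h]

omit [Coalgebra.IsCocomm k C] in
lemma one_pairL {P : Type} [AddCommGroup P] [Module k P] (q : C →ₗ[k] P) :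
    pairL (1 : Point k C H).lin q = TensorProduct.mk k H P 1 ∘ₗ q := by
  have e : pairL (1 : Point k C H).lin q = TensorProduct.map (Algebra.linearMap k H) q ∘ₗ
      LinearMap.rTensor C Coalgebra.counit ∘ₗ (Coalgebra.comul : C →ₗ[k] C ⊗[k] C) := by
    rw [← LinearMap.comp_assoc, LinearMap.map_comp_rTensor]; rfl
  rw [e, Coalgebra.rTensor_counit_comp_comul]
  ext; simp

omit [Coalgebra.IsCocomm k C] in
lemma pairL_one {P : Type} [AddCommGroup P] [Module k P] (q : C →ₗ[k] P) :
    pairL q (1 : Point k C H).lin = (TensorProduct.mk k P H).flip 1 ∘ₗ q := by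
  have e : pairL q (1 : Point k C H).lin = TensorProduct.map q (Algebra.linearMap k H) ∘ₗ
      LinearMap.lTensor C Coalgebra.counit ∘ₗ (Coalgebra.comul : C →ₗ[k] C ⊗[k] C) := by
    rw [← LinearMap.comp_assoc, LinearMap.map_comp_lTensor]; rfl
  rw [e, Coalgebra.lTensor_counit_comp_comul]
  ext; simp

end Monoid

end Point
end Points

section RegSection

variable {k : Type} [Field k]
variable {B C D E : Type} [AddCommGroup B] [Module k B] [Coalgebra k B]
  [AddCommGroup C] [Module k C] [Coalgebra k C]
  [AddCommGroup D] [Module k D] [Coalgebra k D] [AddCommGroup E] [Module k E] [Coalgebra k E]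
  [Coalgebra.IsCocomm k B] [Coalgebra.IsCocomm k C]
  [Coalgebra.IsCocomm k D] [Coalgebra.IsCocomm k E]
variable {H : Type} [Ring H] [Bialgebra k H] {A : Type} [CommRing A] [Algebra k A]

variable (k C A) in
/-- Convolution-invertible linear maps `C → A`, written additively. -/
def Reg : Type := Additive (WithConv (C →ₗ[k] A))ˣ

namespace Reg

noncomputable instance : AddCommGroup (Reg k C A) :=
  inferInstanceAs (AddCommGroup (Additive (WithConv (C →ₗ[k] A))ˣ))

/-- The underlying linear map. -/
def lin (f : Reg k C A) : C →ₗ[k] A := (Additive.toMul f : (WithConv (C →ₗ[k] A))ˣ).val.ofConv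

omit [Coalgebra.IsCocomm k C] in
lemma lin_injective : Function.Injective (lin : Reg k C A → _) := fun _ _ h =>
  Additive.toMul.injective (Units.ext (WithConv.ofConv_injective h))

omit [Coalgebra.IsCocomm k C] in
lemma lin_inj {f g : Reg k C A} : f.lin = g.lin ↔ f = g := lin_injective.eq_iff

lemma lin_add (f g : Reg k C A) : (f + g).lin = conv f.lin g.lin := rfl

lemma lin_zero : (0 : Reg k C A).lin = convOne C A := rfl

lemma isConvInv (f : Reg k C A) : IsConvInv f.lin (-f).lin := by
  rw [IsConvInv, ← lin_add, ← lin_add, add_neg_cancel, neg_add_cancel, lin_zero]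
  exact ⟨rfl, rfl⟩

lemma exists_of_isConvInv {f g : C →ₗ[k] A} (h : IsConvInv f g) :
    ∃ F : Reg k C A, F.lin = f ∧ (-F).lin = g :=
  ⟨Additive.ofMul (⟨WithConv.toConv f, WithConv.toConv g, congrArg WithConv.toConv h.1,
    congrArg WithConv.toConv h.2⟩ : (WithConv (C →ₗ[k] A))ˣ), rfl, rfl⟩

lemma isConvInvertible (f : Reg k C A) : IsConvInvertible f.lin := ⟨_, f.isConvInv⟩

lemma exists_of_isConvInvertible {f : C →ₗ[k] A} (h : IsConvInvertible f) :
    ∃ F : Reg k C A, F.lin = f :=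
  let ⟨_, hg⟩ := h
  let ⟨F, hF, _⟩ := exists_of_isConvInv hg
  ⟨F, hF⟩

omit [Coalgebra.IsCocomm k C] in
lemma isConvInv_comp (f : Reg k D A) (x : Point k C D) :
    IsConvInv (f.lin ∘ₗ x.lin) ((-f).lin ∘ₗ x.lin) := by
  rw [IsConvInv, ← conv_comp_lin, ← conv_comp_lin, f.isConvInv.1, f.isConvInv.2, convOne_comp_lin]
  exact ⟨rfl, rfl⟩

/-- Evaluation of a convolution-invertible map at a point. -/
noncomputable def ev (f : Reg k D A) (x : Point k C D) : Reg k C A :=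
  (exists_of_isConvInv (f.isConvInv_comp x)).choose

lemma ev_lin (f : Reg k D A) (x : Point k C D) : (f.ev x).lin = f.lin ∘ₗ x.lin :=
  (exists_of_isConvInv (f.isConvInv_comp x)).choose_spec.1

@[simp] lemma add_ev (f g : Reg k D A) (x : Point k C D) : (f + g).ev x = f.ev x + g.ev x :=
  lin_injective <| by simp only [ev_lin, lin_add, conv_comp_lin]

@[simp] lemma zero_ev (x : Point k C D) : (0 : Reg k D A).ev x = 0 :=
  lin_injective <| by simp only [ev_lin, lin_zero, convOne_comp_lin]

@[simp] lemma neg_ev (f : Reg k D A) (x : Point k C D) : (-f).ev x = -f.ev x :=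
  eq_neg_of_add_eq_zero_left (by rw [← add_ev, neg_add_cancel, zero_ev])

@[simp] lemma sub_ev (f g : Reg k D A) (x : Point k C D) : (f - g).ev x = f.ev x - g.ev x := by
  simp [sub_eq_add_neg]

@[simp] lemma ev_ev (f : Reg k E A) (y : Point k D E) (x : Point k C D) :
    (f.ev y).ev x = f.ev (y.comp x) :=
  lin_injective <| by simp only [ev_lin, Point.comp_lin, LinearMap.comp_assoc]

@[simp] lemma ev_id (f : Reg k C A) : f.ev (Point.id k C) = f :=
  lin_injective <| by simp [ev_lin]

end Reg

end RegSection

section Linear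

variable {k : Type} [Field k] {C P Q R : Type} [AddCommGroup C] [Module k C] [Coalgebra k C]
  [AddCommGroup P] [Module k P] [AddCommGroup Q] [Module k Q] [AddCommGroup R] [Module k R]

lemma comm_pairL [Coalgebra.IsCocomm k C] (p : C →ₗ[k] P) (q : C →ₗ[k] Q) :
    (TensorProduct.comm k P Q).toLinearMap ∘ₗ pairL p q = pairL q p := by
  have e : (TensorProduct.comm k P Q).toLinearMap ∘ₗ TensorProduct.map p q =
      TensorProduct.map q p ∘ₗ (TensorProduct.comm k C C).toLinearMap := by
    ext; rfl
  rw [pairL, ← LinearMap.comp_assoc, e, LinearMap.comp_assoc]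
  exact congrArg _ (Coalgebra.comm_comp_comul k C)

lemma assoc_symm_pairL (p : C →ₗ[k] P) (q : C →ₗ[k] Q) (r : C →ₗ[k] R) :
    (TensorProduct.assoc k P Q R).symm.toLinearMap ∘ₗ pairL p (pairL q r) =
      pairL (pairL p q) r := by
  rw [← assoc_pairL]
  ext x
  exact (TensorProduct.assoc k P Q R).symm_apply_apply _

end Linear

namespace Point

section Inverse

variable {k : Type} [Field k] {C D E : Type} [AddCommGroup C] [Module k C] [Coalgebra k C]
  [AddCommGroup D] [Module k D] [Coalgebra k D] [AddCommGroup E] [Module k E] [Coalgebra k E]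

lemma exists_inverse (m : Point k D E) (hm : Function.Bijective m.lin) :
    ∃ q : Point k E D, m.comp q = Point.id k E ∧ q.comp m = Point.id k D := by
  let e : D ≃ₗc[k] E := CoalgEquiv.ofBijective (f := m.hom) hm
  refine ⟨⟨e.symm⟩, lin_injective (LinearMap.ext fun x => ?_),
    lin_injective (LinearMap.ext fun x => ?_)⟩
  · exact e.apply_symm_apply x
  · exact e.symm_apply_apply x

lemma isCocomm_of_surjective [Coalgebra.IsCocomm k D] (m : Point k D E)
    (hm : Function.Surjective m.lin) : Coalgebra.IsCocomm k E := by
  refine ⟨?_⟩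
  have h : (TensorProduct.comm k E E).toLinearMap ∘ₗ Coalgebra.comul ∘ₗ m.lin =
      Coalgebra.comul ∘ₗ m.lin := by
    rw [comul_comp_lin, comm_pairL]
  ext x
  obtain ⟨y, rfl⟩ := hm x
  exact LinearMap.congr_fun h y

end Inverse

end Point

section Smash

variable {k : Type} [Field k] {T N H : Type} [Ring T] [Bialgebra k T] [Ring N] [Bialgebra k N]
  [Ring H] [Bialgebra k H]
  {C : Type} [AddCommGroup C] [Module k C] [Coalgebra k C] [Coalgebra.IsCocomm k C]

open Point

lemma IsModuleBialgebra.exists_point {μ : T ⊗[k] N →ₗ[k] N} (h : IsModuleBialgebra μ) :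
    ∃ a : Point k (T ⊗[k] N) N, a.lin = μ := by
  refine ⟨⟨⟨μ, ?_, ?_⟩⟩, rfl⟩
  · ext t n; simpa [mul_comm] using h.counit_act t n
  · exact h.comul_act.symm

/-- The action on points. -/
noncomputable def actPt (a : Point k (T ⊗[k] N) N) (t : Point k C T) (n : Point k C N) :
    Point k C N := a.comp (pair t n)

@[simp] lemma actPt_comp (a : Point k (T ⊗[k] N) N) (t : Point k C T) (n : Point k C N)
    {B : Type} [AddCommGroup B] [Module k B] [Coalgebra k B] [Coalgebra.IsCocomm k B]
    (q : Point k B C) : (actPt a t n).comp q = actPt a (t.comp q) (n.comp q) := by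
  simp [actPt]

lemma actPt_lin (a : Point k (T ⊗[k] N) N) (t : Point k C T) (n : Point k C N) :
    (actPt a t n).lin = a.lin ∘ₗ pairL t.lin n.lin := rfl

section Act

variable {a : Point k (T ⊗[k] N) N} (h : IsModuleBialgebra a.lin)
include h

lemma one_actPt (n : Point k C N) : actPt a 1 n = n := by
  apply lin_injective
  rw [actPt_lin, one_pairL]
  ext c; exact h.one_act (n.lin c)

lemma mul_actPt (t s : Point k C T) (n : Point k C N) :
    actPt a (t * s) n = actPt a t (actPt a s n) := by
  apply lin_injective
  have e : a.lin ∘ₗ LinearMap.rTensor N (LinearMap.mul' k T) =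
      a.lin ∘ₗ LinearMap.lTensor T a.lin ∘ₗ (TensorProduct.assoc k T T N).toLinearMap := by
    ext t s n; exact h.mul_act t s n
  have := congrArg (· ∘ₗ pairL (pairL t.lin s.lin) n.lin) e
  simp only [LinearMap.comp_assoc, rTensor_pairL, assoc_pairL, lTensor_pairL] at this
  exact this

lemma actPt_one (t : Point k C T) : actPt a t 1 = 1 := by
  apply lin_injective
  have e : a.lin ∘ₗ (TensorProduct.mk k T N).flip 1 =
      Algebra.linearMap k N ∘ₗ Coalgebra.counit := by
    ext t; exact h.act_one t
  rw [actPt_lin, pairL_one, ← LinearMap.comp_assoc, e, LinearMap.comp_assoc, counit_comp_lin,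
    one_lin]

lemma actPt_mul (t : Point k C T) (n n' : Point k C N) :
    actPt a t (n * n') = actPt a t n * actPt a t n' := by
  apply lin_injective
  have := congrArg (· ∘ₗ pairL t.lin (pairL n.lin n'.lin)) h.act_mul
  simp only [LinearMap.comp_assoc, rTensor_pairL, lTensor_pairL, comul_comp_lin,
    tensorTensorTensorComm_pairL, map_pairL] at this
  exact this

end Act

variable [Coalgebra.IsCocomm k T] [Coalgebra.IsCocomm k N]

/-- The multiplication `N ⊗ T → H` as a point. -/
noncomputable def smashPoint (iN : N →ₐc[k] H) (iT : T →ₐc[k] H) : Point k (N ⊗[k] T) H :=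
  (ofHom iN).comp fst * (ofHom iT).comp snd

lemma smashPoint_lin (iN : N →ₐc[k] H) (iT : T →ₐc[k] H) :
    (smashPoint iN iT).lin = smashMul iN iT := by
  rw [smashPoint, mul_lin, smashMul, ← ofHom_lin, ← ofHom_lin, ← pair_fst_comp_snd_comp_lin]
  rfl

lemma smashPoint_bijective {μ : T ⊗[k] N →ₗ[k] N} {iN : N →ₐc[k] H} {iT : T →ₐc[k] H}
    (h : IsSmashProduct μ iN iT) : Function.Bijective (smashPoint iN iT).lin := by
  rw [smashPoint_lin]; exact h.bij

lemma IsSmashProduct.isCocomm {μ : T ⊗[k] N →ₗ[k] N} {iN : N →ₐc[k] H} {iT : T →ₐc[k] H}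
    (h : IsSmashProduct μ iN iT) : Coalgebra.IsCocomm k H :=
  (smashPoint iN iT).isCocomm_of_surjective (smashPoint_bijective h).2

/-- The inverse of `smashPoint`. -/
noncomputable def smashInv {μ : T ⊗[k] N →ₗ[k] N} {iN : N →ₐc[k] H} {iT : T →ₐc[k] H}
    (h : IsSmashProduct μ iN iT) : Point k H (N ⊗[k] T) :=
  ((smashPoint iN iT).exists_inverse (smashPoint_bijective h)).choose

lemma smashPoint_comp_smashInv {μ : T ⊗[k] N →ₗ[k] N} {iN : N →ₐc[k] H} {iT : T →ₐc[k] H}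
    (h : IsSmashProduct μ iN iT) : (smashPoint iN iT).comp (smashInv h) = Point.id k H :=
  ((smashPoint iN iT).exists_inverse (smashPoint_bijective h)).choose_spec.1

lemma smashInv_comp_smashPoint {μ : T ⊗[k] N →ₗ[k] N} {iN : N →ₐc[k] H} {iT : T →ₐc[k] H}
    (h : IsSmashProduct μ iN iT) : (smashInv h).comp (smashPoint iN iT) = Point.id k (N ⊗[k] T) :=
  ((smashPoint iN iT).exists_inverse (smashPoint_bijective h)).choose_spec.2

lemma smashPoint_comp_pair (iN : N →ₐc[k] H) (iT : T →ₐc[k] H) (n : Point k C N)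
    (t : Point k C T) :
    (smashPoint iN iT).comp (pair n t) = (ofHom iN).comp n * (ofHom iT).comp t := by
  simp [smashPoint]

/-- The coalgebra projection of a smash product onto `N`. -/
noncomputable def projN {μ : T ⊗[k] N →ₗ[k] N} {iN : N →ₐc[k] H} {iT : T →ₐc[k] H}
    (h : IsSmashProduct μ iN iT) : Point k H N := fst.comp (smashInv h)

/-- The coalgebra projection of a smash product onto `T`. -/
noncomputable def projT {μ : T ⊗[k] N →ₗ[k] N} {iN : N →ₐc[k] H} {iT : T →ₐc[k] H}
    (h : IsSmashProduct μ iN iT) : Point k H T := snd.comp (smashInv h)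

/-- The points of a smash product of bialgebras. -/
noncomputable def smashPoints {a : Point k (T ⊗[k] N) N} {iN : N →ₐc[k] H} {iT : T →ₐc[k] H}
    (h : IsSmashProduct a.lin iN iT) (C : Type) [AddCommGroup C] [Module k C] [Coalgebra k C]
    [Coalgebra.IsCocomm k C] : SmashMonoid (Point k C N) (Point k C T) (Point k C H) where
  act := actPt a
  one_act := one_actPt h.act
  mul_act := mul_actPt h.act
  act_one := actPt_one h.act
  act_mul := actPt_mul h.act
  iN := ⟨⟨(ofHom iN).comp, ofHom_comp_one iN⟩, ofHom_comp_mul iN⟩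
  iT := ⟨⟨(ofHom iT).comp, ofHom_comp_one iT⟩, ofHom_comp_mul iT⟩
  pN x := (projN h).comp x
  pT x := (projT h).comp x
  straighten t n := by
    apply lin_injective
    have := congrArg (· ∘ₗ pairL t.lin n.lin) h.straighten
    simp only [smashCross, LinearMap.comp_assoc, rTensor_pairL, comul_comp_lin, assoc_pairL,
      map_pairL, lTensor_pairL, comm_pairL, assoc_symm_pairL, LinearMap.id_comp] at this
    exact this
  recompose x := by
    change (ofHom iN).comp ((projN h).comp x) * (ofHom iT).comp ((projT h).comp x) = x
    rw [projN, projT, comp_comp, comp_comp, ← smashPoint_comp_pair, pair_eta, ← comp_comp,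
      smashPoint_comp_smashInv, id_comp]
  pN_apply n t := by
    change (projN h).comp ((ofHom iN).comp n * (ofHom iT).comp t) = n
    rw [projN, comp_comp, ← smashPoint_comp_pair, ← comp_comp (smashInv h),
      smashInv_comp_smashPoint, id_comp, fst_comp_pair]
  pT_apply n t := by
    change (projT h).comp ((ofHom iN).comp n * (ofHom iT).comp t) = t
    rw [projT, comp_comp, ← smashPoint_comp_pair, ← comp_comp (smashInv h),
      smashInv_comp_smashPoint, id_comp, snd_comp_pair]

end Smash

section Translate

variable {k : Type} [Field k]
variable {B C D E D' : Type} [AddCommGroup B] [Module k B] [Coalgebra k B]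
  [AddCommGroup C] [Module k C] [Coalgebra k C]
  [AddCommGroup D] [Module k D] [Coalgebra k D] [AddCommGroup E] [Module k E] [Coalgebra k E]
  [AddCommGroup D'] [Module k D'] [Coalgebra k D']
  [Coalgebra.IsCocomm k B] [Coalgebra.IsCocomm k C]
  [Coalgebra.IsCocomm k D] [Coalgebra.IsCocomm k E] [Coalgebra.IsCocomm k D']
variable {H : Type} [Ring H] [Bialgebra k H] {A : Type} [CommRing A] [Algebra k A]

open Point

namespace Reg

variable [Coalgebra.IsCocomm k H]

/-- A convolution-invertible map is trivial along `p` iff its evaluation at `p` vanishes. -/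
lemma ev_eq_zero_iff (F : Reg k D A) (p : Point k E D) :
    F.ev p = 0 ↔ ∀ e, F.lin (p.lin e) = algebraMap k A (Coalgebra.counit e) := by
  rw [← lin_inj, ev_lin, lin_zero, LinearMap.ext_iff]; rfl

lemma ev_eq_zero_iff_tmul (F : Reg k D' A) (p : Point k (D ⊗[k] E) D') :
    F.ev p = 0 ↔ ∀ d e, F.lin (p.lin (d ⊗ₜ[k] e)) =
      algebraMap k A (Coalgebra.counit d * Coalgebra.counit e) := by
  rw [← lin_inj, ev_lin, lin_zero]
  refine ⟨fun h d e => ?_, fun h => TensorProduct.ext' fun d e => ?_⟩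
  · refine (LinearMap.congr_fun h (d ⊗ₜ e)).trans ?_
    simp [convOne, mul_comm]
  · refine (h d e).trans ?_
    simp [convOne, mul_comm]

lemma normalized1_iff (F : Reg k H A) : Normalized1 F.lin ↔
    ∀ (C : Type) [AddCommGroup C] [Module k C] [Coalgebra k C] [Coalgebra.IsCocomm k C],
      F.ev (1 : Point k C H) = 0 := by
  refine ⟨fun h C _ _ _ _ => (ev_eq_zero_iff _ _).2 fun c => ?_, fun h => ?_⟩
  · rw [one_lin, LinearMap.comp_apply, Algebra.linearMap_apply, Algebra.algebraMap_eq_smul_one,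
      map_smul, h, Algebra.algebraMap_eq_smul_one]
  · change F.lin 1 = 1
    have := (ev_eq_zero_iff _ _).1 (h H) 1
    simpa only [one_lin, LinearMap.comp_apply, Bialgebra.counit_one, map_one,
      Algebra.linearMap_apply] using this

lemma ev_pair_one_left_iff (F : Reg k (H ⊗[k] D) A) :
    (∀ d, F.lin (1 ⊗ₜ[k] d) = algebraMap k A (Coalgebra.counit d)) ↔
      F.ev (pair 1 (Point.id k D)) = 0 := by
  rw [ev_eq_zero_iff, pair_lin, one_pairL]; rfl

lemma ev_pair_one_right_iff (F : Reg k (D ⊗[k] H) A) :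
    (∀ d, F.lin (d ⊗ₜ[k] 1) = algebraMap k A (Coalgebra.counit d)) ↔
      F.ev (pair (Point.id k D) 1) = 0 := by
  rw [ev_eq_zero_iff, pair_lin, pairL_one]; rfl

lemma ev_triple_one_left_iff (F : Reg k ((H ⊗[k] D) ⊗[k] E) A) :
    (∀ d e, F.lin ((1 ⊗ₜ[k] d) ⊗ₜ[k] e) =
      algebraMap k A (Coalgebra.counit d * Coalgebra.counit e)) ↔
      F.ev (pair (pair 1 fst) snd) = 0 := by
  have e : (pair (pair (1 : Point k (D ⊗[k] E) H) fst) snd).lin =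
      TensorProduct.map (TensorProduct.mk k H D 1) LinearMap.id := by
    have := pair_fst_comp_snd_comp_lin (pair (1 : Point k D H) (Point.id k D)) (Point.id k E)
    rw [pair_comp, one_comp, id_comp, id_comp, pair_lin (1 : Point k D H), one_pairL] at this
    exact this
  rw [ev_eq_zero_iff_tmul, e]; rfl

lemma ev_triple_one_mid_iff (F : Reg k ((D ⊗[k] H) ⊗[k] E) A) :
    (∀ d e, F.lin ((d ⊗ₜ[k] 1) ⊗ₜ[k] e) =
      algebraMap k A (Coalgebra.counit d * Coalgebra.counit e)) ↔
      F.ev (pair (pair fst 1) snd) = 0 := by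
  have e : (pair (pair fst (1 : Point k (D ⊗[k] E) H)) snd).lin =
      TensorProduct.map ((TensorProduct.mk k D H).flip 1) LinearMap.id := by
    have := pair_fst_comp_snd_comp_lin (pair (Point.id k D) (1 : Point k D H)) (Point.id k E)
    rw [pair_comp, one_comp, id_comp, id_comp, pair_lin (Point.id k D), pairL_one] at this
    exact this
  rw [ev_eq_zero_iff_tmul, e]; rfl

lemma ev_triple_one_right_iff (F : Reg k ((D ⊗[k] E) ⊗[k] H) A) :
    (∀ d e, F.lin ((d ⊗ₜ[k] e) ⊗ₜ[k] 1) =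
      algebraMap k A (Coalgebra.counit d * Coalgebra.counit e)) ↔
      F.ev (pair (Point.id k (D ⊗[k] E)) 1) = 0 := by
  rw [ev_eq_zero_iff_tmul, pair_lin, pairL_one]; rfl

end Reg

section Cochains

variable [Coalgebra.IsCocomm k H]

lemma normalized2_iff (F : Reg k (H ⊗[k] H) A) : Normalized2 F.lin ↔
    F.ev (pair 1 (Point.id k H)) = 0 ∧ F.ev (pair (Point.id k H) 1) = 0 := by
  rw [← Reg.ev_pair_one_left_iff, ← Reg.ev_pair_one_right_iff, ← forall_and]; rfl

lemma normalized3_iff (F : Reg k ((H ⊗[k] H) ⊗[k] H) A) : Normalized3 F.lin ↔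
    F.ev (pair (pair 1 fst) snd) = 0 ∧ F.ev (pair (pair fst 1) snd) = 0 ∧
      F.ev (pair (Point.id k (H ⊗[k] H)) 1) = 0 := by
  rw [← Reg.ev_triple_one_left_iff, ← Reg.ev_triple_one_mid_iff, ← Reg.ev_triple_one_right_iff]
  simp only [Normalized3, forall_and]

lemma Normalized2.ev_left {F : Reg k (H ⊗[k] H) A} (h : Normalized2 F.lin) (x : Point k C H) :
    F.ev (pair 1 x) = 0 := by
  simpa using congrArg (Reg.ev · x) ((normalized2_iff F).1 h).1

lemma Normalized2.ev_right {F : Reg k (H ⊗[k] H) A} (h : Normalized2 F.lin) (x : Point k C H) :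
    F.ev (pair x 1) = 0 := by
  simpa using congrArg (Reg.ev · x) ((normalized2_iff F).1 h).2

lemma lin_ext_triple {D₁ D₂ D₃ : Type} [AddCommGroup D₁] [Module k D₁] [Coalgebra k D₁]
    [AddCommGroup D₂] [Module k D₂] [Coalgebra k D₂] [AddCommGroup D₃] [Module k D₃]
    [Coalgebra k D₃] [Coalgebra.IsCocomm k D₁] [Coalgebra.IsCocomm k D₂]
    [Coalgebra.IsCocomm k D₃] {L L' : (D₁ ⊗[k] D₂) ⊗[k] D₃ →ₗ[k] A}
    (h : L ∘ₗ (pair (pair (fst.comp fst) (snd.comp fst)) snd).lin =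
      L' ∘ₗ (pair (pair (fst.comp fst) (snd.comp fst)) snd).lin) : L = L' := by
  simpa only [pair_eta, pair_fst_snd, id_lin, LinearMap.comp_id] using h

lemma lin_ext_quadruple {D₁ D₂ D₃ D₄ : Type} [AddCommGroup D₁] [Module k D₁] [Coalgebra k D₁]
    [AddCommGroup D₂] [Module k D₂] [Coalgebra k D₂] [AddCommGroup D₃] [Module k D₃]
    [Coalgebra k D₃] [AddCommGroup D₄] [Module k D₄] [Coalgebra k D₄]
    [Coalgebra.IsCocomm k D₁] [Coalgebra.IsCocomm k D₂] [Coalgebra.IsCocomm k D₃]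
    [Coalgebra.IsCocomm k D₄] {L L' : ((D₁ ⊗[k] D₂) ⊗[k] D₃) ⊗[k] D₄ →ₗ[k] A}
    (h : L ∘ₗ (pair (pair (pair (fst.comp (fst.comp fst)) (snd.comp (fst.comp fst)))
        (snd.comp fst)) snd).lin =
      L' ∘ₗ (pair (pair (pair (fst.comp (fst.comp fst)) (snd.comp (fst.comp fst)))
        (snd.comp fst)) snd).lin) : L = L' := by
  simpa only [pair_eta, pair_fst_snd, id_lin, LinearMap.comp_id] using h

lemma cocycle2LHS_comp (F : Reg k (H ⊗[k] H) A) (x y z : Point k C H) :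
    cocycle2LHS F.lin ∘ₗ (pair (pair x y) z).lin =
      (F.ev (pair x y) + F.ev (pair (x * y) z)).lin := by
  rw [cocycle2LHS, conv_comp_lin]
  simp only [LinearMap.comp_assoc, Reg.lin_add, Reg.ev_lin, pair_lin, mul_lin, rTensor_pairL,
    dropR_pairL, counit_comp_lin]

lemma cocycle2RHS_comp (F : Reg k (H ⊗[k] H) A) (x y z : Point k C H) :
    cocycle2RHS F.lin ∘ₗ (pair (pair x y) z).lin =
      (F.ev (pair y z) + F.ev (pair x (y * z))).lin := by
  rw [cocycle2RHS, conv_comp_lin]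
  simp only [LinearMap.comp_assoc, Reg.lin_add, Reg.ev_lin, pair_lin, mul_lin, lTensor_pairL,
    assoc_pairL, dropL_pairL, counit_comp_lin]

lemma cobound2_comp (τ : Reg k H A) (x y : Point k C H) :
    cobound2 τ.lin (-τ).lin ∘ₗ (pair x y).lin = (τ.ev y - τ.ev (x * y) + τ.ev x).lin := by
  rw [cobound2, conv_comp_lin, conv_comp_lin, sub_eq_add_neg, add_assoc, ← Reg.neg_ev]
  simp only [LinearMap.comp_assoc, Reg.lin_add, Reg.ev_lin, pair_lin, mul_lin,
    dropR_pairL, dropL_pairL, counit_comp_lin]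

lemma cobound3_comp (v : Reg k (H ⊗[k] H) A) (x y z : Point k C H) :
    cobound3 v.lin (-v).lin ∘ₗ (pair (pair x y) z).lin =
      (v.ev (pair y z) - v.ev (pair (x * y) z) + v.ev (pair x (y * z)) - v.ev (pair x y)).lin := by
  rw [cobound3, conv_comp_lin, conv_comp_lin, conv_comp_lin, sub_eq_add_neg, sub_eq_add_neg,
    add_assoc, add_assoc, ← Reg.neg_ev, ← Reg.neg_ev]
  simp only [LinearMap.comp_assoc, Reg.lin_add, Reg.ev_lin, pair_lin, mul_lin, p23, m23,
    dropR_pairL, dropL_pairL, counit_comp_lin, assoc_pairL, lTensor_pairL, rTensor_pairL]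

lemma isZ2_iff (F : Reg k (H ⊗[k] H) A) : IsZ2 F.lin ↔
    ∀ (C : Type) [AddCommGroup C] [Module k C] [Coalgebra k C] [Coalgebra.IsCocomm k C],
      Cocycle2 fun x y : Point k C H => F.ev (pair x y) := by
  refine ⟨fun h C _ _ _ _ => ⟨h.1.ev_left, h.1.ev_right, fun x y z => ?_⟩, fun h =>
    ⟨(normalized2_iff F).2 ⟨(h H).one_left _, (h H).one_right _⟩, F.isConvInvertible,
      lin_ext_triple ?_⟩⟩
  · rw [← Reg.lin_inj, ← cocycle2LHS_comp, ← cocycle2RHS_comp, h.2.2]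
  · rw [cocycle2LHS_comp, cocycle2RHS_comp, Reg.lin_inj]
    exact (h _).cocycle _ _ _

lemma isB2_iff (F : Reg k (H ⊗[k] H) A) : IsB2 F.lin ↔ ∃ τ : Reg k H A,
    ∀ (C : Type) [AddCommGroup C] [Module k C] [Coalgebra k C] [Coalgebra.IsCocomm k C],
      τ.ev (1 : Point k C H) = 0 ∧
      ∀ x y : Point k C H, F.ev (pair x y) = τ.ev y - τ.ev (x * y) + τ.ev x := by
  constructor
  · rintro ⟨t, tinv, h1, hi, h⟩
    obtain ⟨τ, rfl, rfl⟩ := Reg.exists_of_isConvInv hi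
    refine ⟨τ, fun C _ _ _ _ => ⟨(Reg.normalized1_iff τ).1 h1 C, fun x y => ?_⟩⟩
    rw [← Reg.lin_inj, Reg.ev_lin, h, cobound2_comp]
  · rintro ⟨τ, h⟩
    refine ⟨τ.lin, (-τ).lin, (Reg.normalized1_iff τ).2 fun C _ _ _ _ => (h C).1, τ.isConvInv, ?_⟩
    have := cobound2_comp τ fst snd
    rwa [← (h _).2, pair_fst_snd, Reg.ev_id, id_lin, LinearMap.comp_id, eq_comm] at this

lemma isB3_iff (J : Reg k ((H ⊗[k] H) ⊗[k] H) A) : IsB3 J.lin ↔ ∃ v : Reg k (H ⊗[k] H) A,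
    ∀ (C : Type) [AddCommGroup C] [Module k C] [Coalgebra k C] [Coalgebra.IsCocomm k C],
      (∀ x : Point k C H, v.ev (pair 1 x) = 0 ∧ v.ev (pair x 1) = 0) ∧
      ∀ x y z : Point k C H, J.ev (pair (pair x y) z) =
        v.ev (pair y z) - v.ev (pair (x * y) z) + v.ev (pair x (y * z)) - v.ev (pair x y) := by
  constructor
  · rintro ⟨t, tinv, h1, hi, h⟩
    obtain ⟨v, rfl, rfl⟩ := Reg.exists_of_isConvInv hi
    refine ⟨v, fun C _ _ _ _ => ⟨fun x => ⟨h1.ev_left x, h1.ev_right x⟩, fun x y z => ?_⟩⟩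
    rw [← Reg.lin_inj, Reg.ev_lin, h, cobound3_comp]
  · rintro ⟨v, h⟩
    refine ⟨v.lin, (-v).lin, (normalized2_iff v).2 ((h H).1 _), v.isConvInv, lin_ext_triple ?_⟩
    rw [cobound3_comp, ← (h _).2, Reg.ev_lin]

lemma exists_of_isB2 {b : H ⊗[k] H →ₗ[k] A} (h : IsB2 b) :
    ∃ B : Reg k (H ⊗[k] H) A, B.lin = b := by
  obtain ⟨t, tinv, h1, hi, rfl⟩ := h
  obtain ⟨τ, rfl, rfl⟩ := Reg.exists_of_isConvInv hi
  refine ⟨τ.ev snd - τ.ev (fst * snd) + τ.ev fst, ?_⟩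
  rw [← cobound2_comp, pair_fst_snd, id_lin, LinearMap.comp_id]

lemma cohomologous2_iff (F F' : Reg k (H ⊗[k] H) A) : Cohomologous2 F.lin F'.lin ↔
    ∃ τ : Reg k H A,
    ∀ (C : Type) [AddCommGroup C] [Module k C] [Coalgebra k C] [Coalgebra.IsCocomm k C],
      τ.ev (1 : Point k C H) = 0 ∧ ∀ x y : Point k C H,
        F.ev (pair x y) = F'.ev (pair x y) + (τ.ev y - τ.ev (x * y) + τ.ev x) := by
  have e : Cohomologous2 F.lin F'.lin ↔ IsB2 (F - F').lin := by
    constructor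
    · rintro ⟨b, hb, h⟩
      obtain ⟨B, rfl⟩ := exists_of_isB2 hb
      rw [← Reg.lin_add, Reg.lin_inj] at h
      rwa [h, add_sub_cancel_left]
    · exact fun h => ⟨_, h, by rw [← Reg.lin_add, add_sub_cancel]⟩
  rw [e, isB2_iff]
  simp only [Reg.sub_ev, sub_eq_iff_eq_add']

lemma isZ3_iff (J : Reg k ((H ⊗[k] H) ⊗[k] H) A) : IsZ3 J.lin ↔
    ∀ (C : Type) [AddCommGroup C] [Module k C] [Coalgebra k C] [Coalgebra.IsCocomm k C],
      Cocycle3 fun x y z : Point k C H => J.ev (pair (pair x y) z) := by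
  have e (C : Type) [AddCommGroup C] [Module k C] [Coalgebra k C] [Coalgebra.IsCocomm k C]
      (x y z w : Point k C H) :
      (conv (J.lin ∘ₗ LinearMap.rTensor H (LinearMap.rTensor H (dropL H H)))
        (conv (J.lin ∘ₗ LinearMap.rTensor H (m23 (H := H)))
          (J.lin ∘ₗ dropR ((H ⊗[k] H) ⊗[k] H) H))) ∘ₗ (pair (pair (pair x y) z) w).lin =
      (J.ev (pair (pair y z) w) + (J.ev (pair (pair x (y * z)) w) +
        J.ev (pair (pair x y) z))).lin := by
    refine (conv_comp_lin _ _ _).trans (congrArg (conv _) (conv_comp_lin _ _ _) |>.trans ?_)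
    simp only [LinearMap.comp_assoc, Reg.lin_add, Reg.ev_lin, pair_lin, mul_lin, m23,
      dropR_pairL, dropL_pairL, counit_comp_lin, assoc_pairL, lTensor_pairL, rTensor_pairL]
  have e' (C : Type) [AddCommGroup C] [Module k C] [Coalgebra k C] [Coalgebra.IsCocomm k C]
      (x y z w : Point k C H) :
      (conv (C := ((H ⊗[k] H) ⊗[k] H) ⊗[k] H)
         (J.lin ∘ₗ LinearMap.rTensor H (LinearMap.rTensor H (LinearMap.mul' k H)))
         (J.lin ∘ₗ (LinearMap.lTensor (H ⊗[k] H) (LinearMap.mul' k H)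
              ∘ₗ (TensorProduct.assoc k (H ⊗[k] H) H H).toLinearMap :
                ((H ⊗[k] H) ⊗[k] H) ⊗[k] H →ₗ[k] (H ⊗[k] H) ⊗[k] H))) ∘ₗ
        (pair (pair (pair x y) z) w).lin =
      (J.ev (pair (pair (x * y) z) w) + J.ev (pair (pair x y) (z * w))).lin := by
    refine (conv_comp_lin _ _ _).trans ?_
    simp only [LinearMap.comp_assoc, Reg.lin_add, Reg.ev_lin, pair_lin, mul_lin,
      assoc_pairL, lTensor_pairL, rTensor_pairL]
  refine ⟨fun h C _ _ _ _ => ?_, fun h => ⟨?_, J.isConvInvertible, ?_⟩⟩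
  · obtain ⟨h1, h2, h3⟩ := (normalized3_iff J).1 h.1
    refine ⟨fun x y => ?_, fun x y => ?_, fun x y => ?_, fun x y z w => ?_⟩
    · simpa using congrArg (Reg.ev · (pair x y)) h1
    · simpa using congrArg (Reg.ev · (pair x y)) h2
    · simpa using congrArg (Reg.ev · (pair x y)) h3
    · rw [← Reg.lin_inj, ← e, ← e', show _ = _ from h.2.2]
  · exact (normalized3_iff J).2 ⟨(h _).one_left _ _, (h _).one_mid _ _, by
      simpa using (h (H ⊗[k] H)).one_right fst snd⟩
  · refine lin_ext_quadruple ?_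
    refine (e (((H ⊗[k] H) ⊗[k] H) ⊗[k] H) _ _ _ _).trans (Eq.trans ?_ (e' (((H ⊗[k] H) ⊗[k] H) ⊗[k] H) _ _ _ _).symm)
    exact congrArg Reg.lin ((h _).cocycle _ _ _ _)

end Cochains

section Meas

variable {T N : Type} [Ring T] [Bialgebra k T] [Ring N] [Bialgebra k N]
  [Coalgebra.IsCocomm k T] [Coalgebra.IsCocomm k N]

lemma measures_iff (θ : Reg k (D ⊗[k] N) A) : Measures θ.lin ↔
    ∀ (C : Type) [AddCommGroup C] [Module k C] [Coalgebra k C] [Coalgebra.IsCocomm k C],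
      AddMeasures fun (c : Point k C D) (n : Point k C N) => θ.ev (pair c n) := by
  have e (C : Type) [AddCommGroup C] [Module k C] [Coalgebra k C] [Coalgebra.IsCocomm k C]
      (c : Point k C D) (n n' : Point k C N) :
      (θ.lin ∘ₗ LinearMap.lTensor D (LinearMap.mul' k N)) ∘ₗ (pair c (pair n n')).lin =
        (θ.ev (pair c (n * n'))).lin := by
    simp only [LinearMap.comp_assoc, Reg.ev_lin, pair_lin, mul_lin, lTensor_pairL]
  have e' (C : Type) [AddCommGroup C] [Module k C] [Coalgebra k C] [Coalgebra.IsCocomm k C]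
      (c : Point k C D) (n n' : Point k C N) :
      (conv (θ.lin ∘ₗ LinearMap.lTensor D (dropR N N))
        (θ.lin ∘ₗ LinearMap.lTensor D (dropL N N))) ∘ₗ (pair c (pair n n')).lin =
        (θ.ev (pair c n) + θ.ev (pair c n')).lin := by
    rw [conv_comp_lin]
    simp only [LinearMap.comp_assoc, Reg.lin_add, Reg.ev_lin, pair_lin, lTensor_pairL,
      dropR_pairL, dropL_pairL, counit_comp_lin]
  rw [Measures, Reg.ev_pair_one_right_iff]
  refine ⟨fun h C _ _ _ _ => ⟨fun c n n' => ?_, fun c => ?_⟩, fun h => ⟨?_, (h _).map_one _⟩⟩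
  · rw [← Reg.lin_inj, ← e, ← e', h.1]
  · simpa using congrArg (Reg.ev · c) h.2
  · have := (h _).map_mul fst (fst.comp snd) (snd.comp snd)
    rw [← Reg.lin_inj, ← e, ← e'] at this
    simpa only [pair_eta, pair_fst_snd, id_lin, LinearMap.comp_id] using this

lemma isRegMeas1_iff (g : Reg k (T ⊗[k] N) A) : IsRegMeas1 g.lin ↔
    ∀ (C : Type) [AddCommGroup C] [Module k C] [Coalgebra k C] [Coalgebra.IsCocomm k C],
      AddMeasures (fun (t : Point k C T) (n : Point k C N) => g.ev (pair t n)) ∧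
      ∀ n : Point k C N, g.ev (pair 1 n) = 0 := by
  rw [IsRegMeas1, measures_iff, MeasNormalized1, Reg.ev_pair_one_left_iff]
  refine ⟨fun h C _ _ _ _ => ⟨h.1 C, fun n => ?_⟩, fun h => ⟨fun C _ _ _ _ => (h C).1,
    (h _).2 _, g.isConvInvertible⟩⟩
  simpa using congrArg (Reg.ev · n) h.2.1

variable {a : Point k (T ⊗[k] N) N} {iN : N →ₐc[k] H} {iT : T →ₐc[k] H}

lemma measCobound_comp (g : Reg k (T ⊗[k] N) A) (h : IsSmashProduct a.lin iN iT)
    (t s : Point k C T) (n : Point k C N) :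
    measCobound a.lin g.lin (-g).lin ∘ₗ (pair (pair t s) n).lin =
      ((smashPoints h C).delta (fun t n => g.ev (pair t n)) t s n).lin := by
  change _ = (g.ev (pair s n) - g.ev (pair (t * s) n) + g.ev (pair t (actPt a s n))).lin
  rw [measCobound, conv_comp_lin, conv_comp_lin, sub_eq_add_neg, add_assoc, ← Reg.neg_ev]
  simp only [LinearMap.comp_assoc, Reg.lin_add, Reg.ev_lin, pair_lin, mul_lin, actPt_lin,
    dropL_pairL, counit_comp_lin, assoc_pairL, lTensor_pairL, rTensor_pairL]

/-- The measuring coboundary as a convolution-invertible map. -/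
lemma exists_measCobound (g : Reg k (T ⊗[k] N) A) (h : IsSmashProduct a.lin iN iT) :
    ∃ d : Reg k ((T ⊗[k] T) ⊗[k] N) A, measCobound a.lin g.lin (-g).lin = d.lin ∧
    ∀ (C : Type) [AddCommGroup C] [Module k C] [Coalgebra k C] [Coalgebra.IsCocomm k C]
      (t s : Point k C T) (n : Point k C N), d.ev (pair (pair t s) n) =
        (smashPoints h C).delta (fun t n => g.ev (pair t n)) t s n := by
  refine ⟨(smashPoints h ((T ⊗[k] T) ⊗[k] N)).delta (fun t n => g.ev (pair t n))
    (fst.comp fst) (snd.comp fst) snd, ?_, fun C _ _ _ _ t s n => ?_⟩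
  · rw [← measCobound_comp]
    simp only [pair_eta, pair_fst_snd, id_lin, LinearMap.comp_id]
  · rw [← Reg.lin_inj, Reg.ev_lin, ← measCobound_comp, ← measCobound_comp]
    simp only [pair_eta, pair_fst_snd, id_lin, LinearMap.comp_id]

lemma isMeasB2_iff (f : Reg k ((T ⊗[k] T) ⊗[k] N) A) (h : IsSmashProduct a.lin iN iT) :
    IsMeasB2 a.lin f.lin ↔ ∃ g : Reg k (T ⊗[k] N) A, IsRegMeas1 g.lin ∧
    ∀ (C : Type) [AddCommGroup C] [Module k C] [Coalgebra k C] [Coalgebra.IsCocomm k C]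
      (t s : Point k C T) (n : Point k C N), f.ev (pair (pair t s) n) =
        (smashPoints h C).delta (fun t n => g.ev (pair t n)) t s n := by
  constructor
  · rintro ⟨g, ginv, h1, hi, e⟩
    obtain ⟨g, rfl, rfl⟩ := Reg.exists_of_isConvInv hi
    refine ⟨g, h1, fun C _ _ _ _ t s n => ?_⟩
    rw [← Reg.lin_inj, Reg.ev_lin, e, measCobound_comp g h]
  · rintro ⟨g, h1, e⟩
    refine ⟨g.lin, (-g).lin, h1, g.isConvInv, lin_ext_triple ?_⟩
    rw [measCobound_comp g h, ← e, Reg.ev_lin]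

lemma measCohomologous2_iff (f f' : Reg k ((T ⊗[k] T) ⊗[k] N) A)
    (h : IsSmashProduct a.lin iN iT) :
    MeasCohomologous2 a.lin f.lin f'.lin ↔ ∃ g : Reg k (T ⊗[k] N) A, IsRegMeas1 g.lin ∧
    ∀ (C : Type) [AddCommGroup C] [Module k C] [Coalgebra k C] [Coalgebra.IsCocomm k C]
      (t s : Point k C T) (n : Point k C N), f.ev (pair (pair t s) n) =
        f'.ev (pair (pair t s) n) +
        (smashPoints h C).delta (fun t n => g.ev (pair t n)) t s n := by
  have e : MeasCohomologous2 a.lin f.lin f'.lin ↔ IsMeasB2 a.lin (f - f').lin := by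
    constructor
    · rintro ⟨b, hb, e⟩
      obtain ⟨g, ginv, h1, hi, rfl⟩ := id hb
      obtain ⟨g, rfl, rfl⟩ := Reg.exists_of_isConvInv hi
      obtain ⟨d, hd, -⟩ := exists_measCobound g h
      rw [hd, ← Reg.lin_add, Reg.lin_inj] at e
      rwa [e, add_sub_cancel_left, ← hd]
    · exact fun h => ⟨_, h, by rw [← Reg.lin_add, add_sub_cancel]⟩
  rw [e, isMeasB2_iff _ h]
  simp only [Reg.sub_ev, sub_eq_iff_eq_add']

lemma isMeasZ1_iff (f : Reg k (T ⊗[k] N) A) (h : IsSmashProduct a.lin iN iT) :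
    IsMeasZ1 a.lin f.lin ↔ IsRegMeas1 f.lin ∧
    ∀ (C : Type) [AddCommGroup C] [Module k C] [Coalgebra k C] [Coalgebra.IsCocomm k C]
      (t s : Point k C T) (n : Point k C N),
        (smashPoints h C).delta (fun t n => f.ev (pair t n)) t s n = 0 := by
  have e (C : Type) [AddCommGroup C] [Module k C] [Coalgebra k C] [Coalgebra.IsCocomm k C]
      (t s : Point k C T) (n : Point k C N) :
      (f.lin ∘ₗ LinearMap.rTensor N (LinearMap.mul' k T)) ∘ₗ (pair (pair t s) n).lin =
        (f.ev (pair (t * s) n)).lin := by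
    simp only [LinearMap.comp_assoc, Reg.ev_lin, pair_lin, mul_lin, rTensor_pairL]
  have e' (C : Type) [AddCommGroup C] [Module k C] [Coalgebra k C] [Coalgebra.IsCocomm k C]
      (t s : Point k C T) (n : Point k C N) :
      (conv (f.lin ∘ₗ LinearMap.rTensor N (dropL T T)) (f.lin ∘ₗ LinearMap.lTensor T a.lin ∘ₗ
        (TensorProduct.assoc k T T N).toLinearMap)) ∘ₗ (pair (pair t s) n).lin =
        (f.ev (pair s n) + f.ev (pair t (actPt a s n))).lin := by
    rw [conv_comp_lin]
    simp only [LinearMap.comp_assoc, Reg.lin_add, Reg.ev_lin, pair_lin, lTensor_pairL, actPt_lin,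
      rTensor_pairL, assoc_pairL, dropL_pairL, counit_comp_lin]
  have e'' (C : Type) [AddCommGroup C] [Module k C] [Coalgebra k C] [Coalgebra.IsCocomm k C]
      (t s : Point k C T) (n : Point k C N) :
      (smashPoints h C).delta (fun t n => f.ev (pair t n)) t s n = 0 ↔
        f.ev (pair (t * s) n) = f.ev (pair s n) + f.ev (pair t (actPt a s n)) := by
    change f.ev (pair s n) - f.ev (pair (t * s) n) + f.ev (pair t (actPt a s n)) = 0 ↔ _
    rw [sub_add_eq_add_sub, sub_eq_zero, eq_comm]
  refine and_congr_right fun _ => ⟨fun hf C _ _ _ _ t s n => ?_, fun hf => lin_ext_triple ?_⟩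
  · rw [e'', ← Reg.lin_inj, ← e, ← e', show _ = _ from hf]
  · rw [e, e', Reg.lin_inj, ← e'']
    exact hf _ _ _ _

lemma isMeasZ2_iff (f : Reg k ((T ⊗[k] T) ⊗[k] N) A) (h : IsSmashProduct a.lin iN iT) :
    IsMeasZ2 a.lin f.lin ↔
    ∀ (C : Type) [AddCommGroup C] [Module k C] [Coalgebra k C] [Coalgebra.IsCocomm k C],
      (smashPoints h C).MeasCocycle fun t s n => f.ev (pair (pair t s) n) := by
  have e (C : Type) [AddCommGroup C] [Module k C] [Coalgebra k C] [Coalgebra.IsCocomm k C]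
      (t s r : Point k C T) (n : Point k C N) :
      (conv (C := ((T ⊗[k] T) ⊗[k] T) ⊗[k] N)
       (f.lin ∘ₗ (LinearMap.lTensor (T ⊗[k] T) a.lin
          ∘ₗ (TensorProduct.assoc k (T ⊗[k] T) T N).toLinearMap :
            ((T ⊗[k] T) ⊗[k] T) ⊗[k] N →ₗ[k] (T ⊗[k] T) ⊗[k] N))
       (f.lin ∘ₗ LinearMap.rTensor N (LinearMap.rTensor T (LinearMap.mul' k T)))) ∘ₗ
        (pair (pair (pair t s) r) n).lin =
      (f.ev (pair (pair t s) (actPt a r n)) + f.ev (pair (pair (t * s) r) n)).lin := by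
    refine (conv_comp_lin _ _ _).trans ?_
    simp only [LinearMap.comp_assoc, Reg.lin_add, Reg.ev_lin, pair_lin, mul_lin, actPt_lin,
      assoc_pairL, lTensor_pairL, rTensor_pairL]
  have e' (C : Type) [AddCommGroup C] [Module k C] [Coalgebra k C] [Coalgebra.IsCocomm k C]
      (t s r : Point k C T) (n : Point k C N) :
      (conv (C := ((T ⊗[k] T) ⊗[k] T) ⊗[k] N)
           (f.lin ∘ₗ LinearMap.rTensor N (LinearMap.rTensor T (dropL T T)))
           (f.lin ∘ₗ LinearMap.rTensor N
              ((LinearMap.lTensor T (LinearMap.mul' k T)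
                ∘ₗ (TensorProduct.assoc k T T T).toLinearMap :
                  (T ⊗[k] T) ⊗[k] T →ₗ[k] T ⊗[k] T)))) ∘ₗ
        (pair (pair (pair t s) r) n).lin =
      (f.ev (pair (pair s r) n) + f.ev (pair (pair t (s * r)) n)).lin := by
    refine (conv_comp_lin _ _ _).trans ?_
    simp only [LinearMap.comp_assoc, Reg.lin_add, Reg.ev_lin, pair_lin, mul_lin, dropL_pairL,
      counit_comp_lin, assoc_pairL, lTensor_pairL, rTensor_pairL]
  have hn : MeasNormalized2 f.lin ↔
      f.ev (pair (pair 1 fst) snd) = 0 ∧ f.ev (pair (pair fst 1) snd) = 0 := by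
    rw [← Reg.ev_triple_one_left_iff, ← Reg.ev_triple_one_mid_iff]
    simp only [MeasNormalized2, forall_and]
  rw [IsMeasZ2, IsRegMeas2, measures_iff, hn]
  refine ⟨fun ⟨⟨hm, ⟨h1, h2⟩, _⟩, hc⟩ C _ _ _ _ => ⟨fun t s => ⟨(hm C).map_mul _,
    (hm C).map_one _⟩, fun t n => ?_, fun t n => ?_, fun t s r n => ?_⟩,
    fun hf => ⟨⟨fun C _ _ _ _ => ⟨fun c n n' => ?_, fun c => ?_⟩,
      ⟨(hf _).one_left _ _, (hf _).one_right _ _⟩, f.isConvInvertible⟩, lin_ext_quadruple ?_⟩⟩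
  · simpa using congrArg (Reg.ev · (pair t n)) h1
  · simpa using congrArg (Reg.ev · (pair t n)) h2
  · change f.ev (pair (pair t s) (actPt a r n)) + _ = _
    rw [← Reg.lin_inj, ← e, ← e', show _ = _ from hc]
  · rw [← pair_eta c]; exact ((hf C).meas _ _).1 n n'
  · rw [← pair_eta c]; exact ((hf C).meas _ _).2
  · refine (e (((T ⊗[k] T) ⊗[k] T) ⊗[k] N) _ _ _ _).trans (Eq.trans ?_ (e' (((T ⊗[k] T) ⊗[k] T) ⊗[k] N) _ _ _ _).symm)
    exact congrArg Reg.lin ((hf _).cocycle _ _ _ _)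

lemma isStabilityWitness_iff (f : Reg k (N ⊗[k] N) A) (g : Reg k (T ⊗[k] N) A)
    (h : IsSmashProduct a.lin iN iT) :
    IsStabilityWitness a.lin f.lin (-f).lin g.lin (-g).lin ↔
    ∀ (C : Type) [AddCommGroup C] [Module k C] [Coalgebra k C] [Coalgebra.IsCocomm k C],
      (smashPoints h C).Witness (fun n n' => f.ev (pair n n')) fun t n => g.ev (pair t n) := by
  have e (C : Type) [AddCommGroup C] [Module k C] [Coalgebra k C] [Coalgebra.IsCocomm k C]
      (t : Point k C T) (n n' : Point k C N) :
      stabLHS a.lin f.lin (-f).lin ∘ₗ (pair t (pair n n')).lin =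
      (f.ev (pair n n') - f.ev (pair (actPt a t n) (actPt a t n'))).lin := by
    rw [stabLHS, conv_comp_lin, sub_eq_add_neg, ← Reg.neg_ev]
    simp only [LinearMap.comp_assoc, Reg.lin_add, Reg.ev_lin, pair_lin, actPt_lin, dropL_pairL,
      counit_comp_lin, rTensor_pairL, comul_comp_lin, tensorTensorTensorComm_pairL, map_pairL]
  have e' (C : Type) [AddCommGroup C] [Module k C] [Coalgebra k C] [Coalgebra.IsCocomm k C]
      (t : Point k C T) (n n' : Point k C N) :
      stabRHS g.lin (-g).lin ∘ₗ (pair t (pair n n')).lin =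
      (g.ev (pair t n) - g.ev (pair t (n * n')) + g.ev (pair t n')).lin := by
    rw [stabRHS, conv_comp_lin, conv_comp_lin, sub_eq_add_neg, add_assoc, ← Reg.neg_ev]
    simp only [LinearMap.comp_assoc, Reg.lin_add, Reg.ev_lin, pair_lin, mul_lin, dropL_pairL,
      dropR_pairL, counit_comp_lin, lTensor_pairL]
  rw [IsStabilityWitness, MeasNormalized1, Reg.ev_pair_one_left_iff, Reg.ev_pair_one_right_iff]
  refine ⟨fun ⟨h1, h2, _, hs⟩ C _ _ _ _ => ⟨fun n => ?_, fun t => ?_, fun t n n' => ?_⟩,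
    fun hw => ⟨(hw _).one_left _, (hw _).one_right _, g.isConvInv, ?_⟩⟩
  · simpa using congrArg (Reg.ev · n) h1
  · simpa using congrArg (Reg.ev · t) h2
  · rw [← Reg.lin_inj, ← e', ← hs, e]; rfl
  · have := (hw _).stab fst (fst.comp snd) (snd.comp snd)
    rw [← Reg.lin_inj, ← e'] at this
    replace this := (e _ _ _ _).trans this
    simpa only [pair_eta, pair_fst_snd, id_lin, LinearMap.comp_id] using this

lemma isMeasB1_of {f : Reg k (T ⊗[k] N) A} (h : IsSmashProduct a.lin iN iT) {τ : Reg k N A}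
    (hτ : ∀ (C : Type) [AddCommGroup C] [Module k C] [Coalgebra k C] [Coalgebra.IsCocomm k C],
      (∀ n n' : Point k C N, τ.ev (n * n') = τ.ev n + τ.ev n') ∧
      ∀ (t : Point k C T) (n : Point k C N),
        f.ev (pair t n) = τ.ev n - τ.ev ((smashPoints h C).act t n)) : IsMeasB1 a.lin f.lin := by
  have hm : τ.lin ∘ₗ LinearMap.mul' k N = LinearMap.mul' k A ∘ₗ TensorProduct.map τ.lin τ.lin := by
    have := (hτ _).1 fst snd
    rw [← Reg.lin_inj, Reg.lin_add, Reg.ev_lin, Reg.ev_lin, Reg.ev_lin, mul_lin, conv_eq_pairL,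
      ← map_pairL, fst_lin, snd_lin, pairL_dropR_dropL] at this
    exact this
  have h1 : τ.lin 1 = 1 := (Reg.normalized1_iff τ).2 fun C _ _ _ _ => by
    simpa using (hτ C).1 1 1
  refine ⟨AlgHom.ofLinearMap τ.lin h1 fun x y => LinearMap.congr_fun hm (x ⊗ₜ y), (-τ).lin,
    τ.isConvInv, ?_⟩
  have := (hτ _).2 fst snd
  rw [pair_fst_snd, Reg.ev_id] at this
  rw [this, sub_eq_add_neg, ← Reg.neg_ev, Reg.lin_add, Reg.ev_lin, Reg.ev_lin]
  change conv _ ((-τ).lin ∘ₗ (actPt a fst snd).lin) = _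
  rw [actPt, pair_fst_snd, comp_id]
  rfl

end Meas

end Translate

section Main

variable {k : Type} [Field k] {T N H A : Type} [Ring T] [Bialgebra k T] [Ring N] [Bialgebra k N]
  [Ring H] [Bialgebra k H] [CommRing A] [Algebra k A]
  [Coalgebra.IsCocomm k T] [Coalgebra.IsCocomm k N]

open Point

section Projections

variable {μ : T ⊗[k] N →ₗ[k] N} {iN : N →ₐc[k] H} {iT : T →ₐc[k] H}

lemma projN_mul (h : IsSmashProduct μ iN iT) (n : N) (t : T) :
    (projN h).lin (iN n * iT t) = Coalgebra.counit (R := k) t • n := by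
  have e : (projN h).comp (smashPoint iN iT) = fst := by
    rw [projN, comp_comp, smashInv_comp_smashPoint, comp_id]
  have := congrArg (fun p : Point k _ _ => p.lin (n ⊗ₜ[k] t)) e
  rw [comp_lin, smashPoint_lin] at this
  exact this.trans (by simp [fst_lin, dropR])

lemma projT_mul (h : IsSmashProduct μ iN iT) (n : N) (t : T) :
    (projT h).lin (iN n * iT t) = Coalgebra.counit (R := k) n • t := by
  have e : (projT h).comp (smashPoint iN iT) = snd := by
    rw [projT, comp_comp, smashInv_comp_smashPoint, comp_id]
  have := congrArg (fun p : Point k _ _ => p.lin (n ⊗ₜ[k] t)) e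
  rw [comp_lin, smashPoint_lin] at this
  exact this.trans (by simp [snd_lin, dropL])

lemma iotaOf_iff (h : IsSmashProduct μ iN iT) (f : T ⊗[k] N →ₗ[k] A) (F : H ⊗[k] H →ₗ[k] A) :
    IotaOf iN iT f F ↔ F = f ∘ₗ TensorProduct.map (projT h).lin (projN h).lin := by
  have e : IotaOf iN iT f (f ∘ₗ TensorProduct.map (projT h).lin (projN h).lin) :=
    fun n t n' t' => by
      simp only [LinearMap.comp_apply, TensorProduct.map_tmul, projN_mul, projT_mul,
        ← TensorProduct.smul_tmul', TensorProduct.tmul_smul, map_smul, smul_smul]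
      rw [Algebra.smul_def]
      congr 2; ring
  refine ⟨fun hF => ?_, fun hF => hF ▸ e⟩
  have hs := TensorProduct.map_surjective h.bij.2 h.bij.2
  rw [← LinearMap.cancel_right hs]
  refine TensorProduct.ext_fourfold' fun n t n' t' => ?_
  exact (hF n t n' t').trans (e n t n' t').symm

lemma jOf_iff (h : IsSmashProduct μ iN iT) (f : (T ⊗[k] T) ⊗[k] N →ₗ[k] A)
    (J : (H ⊗[k] H) ⊗[k] H →ₗ[k] A) :
    JOf iN iT f J ↔ J = f ∘ₗ TensorProduct.map
      (TensorProduct.map (projT h).lin (projT h).lin) (projN h).lin := by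
  have e : JOf iN iT f (f ∘ₗ TensorProduct.map
      (TensorProduct.map (projT h).lin (projT h).lin) (projN h).lin) :=
    fun n t n' t' n'' t'' => by
      simp only [LinearMap.comp_apply, TensorProduct.map_tmul, projN_mul, projT_mul,
        ← TensorProduct.smul_tmul', TensorProduct.tmul_smul, map_smul, smul_smul]
      rw [Algebra.smul_def]
      congr 2; ring
  refine ⟨fun hF => ?_, fun hF => hF ▸ e⟩
  have hs := TensorProduct.map_surjective (TensorProduct.map_surjective h.bij.2 h.bij.2) h.bij.2
  rw [← LinearMap.cancel_right hs]
  ext n t n' t' n'' t''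
  exact (hF n t n' t' n'' t'').trans (e n t n' t' n'' t'').symm

lemma IotaOf.conv (h : IsSmashProduct μ iN iT) [Coalgebra.IsCocomm k H]
    {f f' : T ⊗[k] N →ₗ[k] A} {F F' : H ⊗[k] H →ₗ[k] A}
    (hF : IotaOf iN iT f F) (hF' : IotaOf iN iT f' F') :
    IotaOf iN iT (conv f f') (SmashPaper.conv F F') := by
  rw [iotaOf_iff h] at *
  rw [hF, hF', ← pair_fst_comp_snd_comp_lin, conv_comp_lin]

end Projections

variable [Coalgebra.IsCocomm k H]

lemma exists_res {E : Type} [Ring E] [Bialgebra k E] [Coalgebra.IsCocomm k E] (i : E →ₐc[k] H)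
    (F : Reg k (H ⊗[k] H) A) : ∃ f : Reg k (E ⊗[k] E) A,
    F.lin ∘ₗ TensorProduct.map i.toLinearMap i.toLinearMap = f.lin ∧
    ∀ (C : Type) [AddCommGroup C] [Module k C] [Coalgebra k C] [Coalgebra.IsCocomm k C]
      (x y : Point k C E), f.ev (pair x y) =
        F.ev (pair ((ofHom i).comp x) ((ofHom i).comp y)) := by
  refine ⟨F.ev (pair ((ofHom i).comp fst) ((ofHom i).comp snd)), ?_, fun C _ _ _ _ x y => ?_⟩
  · rw [Reg.ev_lin, pair_fst_comp_snd_comp_lin, ofHom_lin]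
  · simp

lemma exists_res_triple {E : Type} [Ring E] [Bialgebra k E] [Coalgebra.IsCocomm k E]
    (i : E →ₐc[k] H) (J : Reg k ((H ⊗[k] H) ⊗[k] H) A) : ∃ f : Reg k ((E ⊗[k] E) ⊗[k] E) A,
    J.lin ∘ₗ TensorProduct.map (TensorProduct.map i.toLinearMap i.toLinearMap) i.toLinearMap =
      f.lin ∧
    ∀ (C : Type) [AddCommGroup C] [Module k C] [Coalgebra k C] [Coalgebra.IsCocomm k C]
      (x y z : Point k C E), f.ev (pair (pair x y) z) =
        J.ev (pair (pair ((ofHom i).comp x) ((ofHom i).comp y)) ((ofHom i).comp z)) := by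
  refine ⟨J.ev (pair ((pair ((ofHom i).comp fst) ((ofHom i).comp snd)).comp fst)
    ((ofHom i).comp snd)), ?_, fun C _ _ _ _ x y z => ?_⟩
  · rw [Reg.ev_lin, pair_fst_comp_snd_comp_lin, pair_fst_comp_snd_comp_lin, ofHom_lin]
  · simp

variable {a : Point k (T ⊗[k] N) N} {iN : N →ₐc[k] H} {iT : T →ₐc[k] H}

lemma exists_iotaOf (h : IsSmashProduct a.lin iN iT) (f : Reg k (T ⊗[k] N) A)
    {F : H ⊗[k] H →ₗ[k] A} (hF : IotaOf iN iT f.lin F) : ∃ F' : Reg k (H ⊗[k] H) A, F = F'.lin ∧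
    ∀ (C : Type) [AddCommGroup C] [Module k C] [Coalgebra k C] [Coalgebra.IsCocomm k C]
      (x y : Point k C H), F'.ev (pair x y) =
        f.ev (pair ((smashPoints h C).pT x) ((smashPoints h C).pN y)) := by
  refine ⟨f.ev (pair ((projT h).comp fst) ((projN h).comp snd)), ?_, fun C _ _ _ _ x y => ?_⟩
  · rw [(iotaOf_iff h f.lin F).1 hF, Reg.ev_lin, pair_fst_comp_snd_comp_lin]
  · simp; rfl

lemma exists_jOf (h : IsSmashProduct a.lin iN iT) (f : Reg k ((T ⊗[k] T) ⊗[k] N) A)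
    {J : (H ⊗[k] H) ⊗[k] H →ₗ[k] A} (hJ : JOf iN iT f.lin J) :
    ∃ J' : Reg k ((H ⊗[k] H) ⊗[k] H) A, J = J'.lin ∧
    ∀ (C : Type) [AddCommGroup C] [Module k C] [Coalgebra k C] [Coalgebra.IsCocomm k C]
      (x y z : Point k C H), J'.ev (pair (pair x y) z) =
        f.ev (pair (pair ((smashPoints h C).pT x) ((smashPoints h C).pT y))
          ((smashPoints h C).pN z)) := by
  refine ⟨f.ev (pair ((pair ((projT h).comp fst) ((projT h).comp snd)).comp fst)
    ((projN h).comp snd)), ?_, fun C _ _ _ _ x y z => ?_⟩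
  · rw [(jOf_iff h f.lin J).1 hJ, Reg.ev_lin, pair_fst_comp_snd_comp_lin,
      pair_fst_comp_snd_comp_lin]
  · simp; rfl

/-- The 2-cochain on a smash product built from a 2-cochain on `N` and a map `T ⊗ N → A`. -/
lemma exists_glue (h : IsSmashProduct a.lin iN iT) (f : Reg k (N ⊗[k] N) A)
    (g : Reg k (T ⊗[k] N) A) : ∃ F : Reg k (H ⊗[k] H) A,
    ∀ (C : Type) [AddCommGroup C] [Module k C] [Coalgebra k C] [Coalgebra.IsCocomm k C]
      (x y : Point k C H), F.ev (pair x y) =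
        f.ev (pair ((smashPoints h C).pN x)
          ((smashPoints h C).act ((smashPoints h C).pT x) ((smashPoints h C).pN y))) +
        g.ev (pair ((smashPoints h C).pT x) ((smashPoints h C).pN y)) := by
  refine ⟨f.ev (pair ((projN h).comp fst) (actPt a ((projT h).comp fst) ((projN h).comp snd))) +
    g.ev (pair ((projT h).comp fst) ((projN h).comp snd)), fun C _ _ _ _ x y => ?_⟩
  simp; rfl

lemma exists_cobound (τ : Reg k H A) : ∃ B : Reg k (H ⊗[k] H) A,
    ∀ (C : Type) [AddCommGroup C] [Module k C] [Coalgebra k C] [Coalgebra.IsCocomm k C]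
      (x y : Point k C H), B.ev (pair x y) = τ.ev y - τ.ev (x * y) + τ.ev x :=
  ⟨τ.ev snd - τ.ev (fst * snd) + τ.ev fst, fun C _ _ _ _ x y => by simp⟩

lemma isZ2_zero : IsZ2 (0 : Reg k (H ⊗[k] H) A).lin :=
  (isZ2_iff _).2 fun C _ _ _ _ => by constructor <;> simp

lemma isB2_iff_cohomologous2_zero (F : Reg k (H ⊗[k] H) A) :
    IsB2 F.lin ↔ Cohomologous2 F.lin (0 : Reg k (H ⊗[k] H) A).lin := by
  simp [isB2_iff, cohomologous2_iff]

/-- Within its class, a 2-cocycle on `H` can be chosen trivial on `N ⊗ T` and `T ⊗ T`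
if it restricts to a coboundary on `T`. -/
lemma exists_adjust (h : IsSmashProduct a.lin iN iT) {F : Reg k (H ⊗[k] H) A}
    {f : Reg k (N ⊗[k] N) A} (hF : IsZ2 F.lin) (hT : IsB2 (resTT iT F.lin))
    (hN : Cohomologous2 (resNN iN F.lin) f.lin) :
    ∃ (τ : Reg k H A) (F₁ : Reg k (H ⊗[k] H) A),
    ∀ (C : Type) [AddCommGroup C] [Module k C] [Coalgebra k C] [Coalgebra.IsCocomm k C],
      τ.ev (1 : Point k C H) = 0 ∧
      (∀ x y : Point k C H,
        F₁.ev (pair x y) = F.ev (pair x y) - (τ.ev y - τ.ev (x * y) + τ.ev x)) ∧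
      Cocycle2 (fun x y : Point k C H => F₁.ev (pair x y)) ∧
      (∀ n n', F₁.ev (pair ((smashPoints h C).iN n) ((smashPoints h C).iN n')) =
        f.ev (pair n n')) ∧
      (∀ n t, F₁.ev (pair ((smashPoints h C).iN n) ((smashPoints h C).iT t)) = 0) ∧
      (∀ s t, F₁.ev (pair ((smashPoints h C).iT s) ((smashPoints h C).iT t)) = 0) := by
  obtain ⟨fN, eN, hfN⟩ := exists_res iN F
  obtain ⟨fT, eT, hfT⟩ := exists_res iT F
  rw [resNN, eN, cohomologous2_iff] at hN
  rw [resTT, eT, isB2_iff] at hT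
  obtain ⟨τN, hτN⟩ := hN
  obtain ⟨τT, hτT⟩ := hT
  have hτ : ∃ τ : Reg k H A,
      ∀ (C : Type) [AddCommGroup C] [Module k C] [Coalgebra k C] [Coalgebra.IsCocomm k C]
      (x : Point k C H), τ.ev x = τN.ev ((smashPoints h C).pN x) + τT.ev ((smashPoints h C).pT x) -
        F.ev (pair ((smashPoints h C).iN ((smashPoints h C).pN x))
          ((smashPoints h C).iT ((smashPoints h C).pT x))) := by
    refine ⟨τN.ev (projN h) + τT.ev (projT h) - F.ev (pair ((ofHom iN).comp (projN h))
      ((ofHom iT).comp (projT h))), fun C _ _ _ _ x => ?_⟩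
    simp; rfl
  obtain ⟨τ, hτ⟩ := hτ
  obtain ⟨B, hB⟩ := exists_cobound τ
  refine ⟨τ, F - B, fun C _ _ _ _ => ?_⟩
  have hF := (isZ2_iff F).1 hF C
  have h1 : τ.ev (1 : Point k C H) = 0 := by
    rw [hτ]
    simpa [(hτN C).1, (hτT C).1] using hF.one_left 1
  have hF₁ (x y : Point k C H) :
      (F - B).ev (pair x y) = F.ev (pair x y) - (τ.ev y - τ.ev (x * y) + τ.ev x) := by
    rw [Reg.sub_ev, hB]
  exact ⟨h1, hF₁, SmashMonoid.adjust_cocycle hF h1 hF₁,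
    SmashMonoid.adjust_apply (S := smashPoints h C) hF (hτN C).1 (hτT C).1
      (fun n n' => (hfN C n n').symm.trans ((hτN C).2 n n'))
      (fun t t' => (hfT C t t').symm.trans ((hτT C).2 t t')) (hτ C) hF₁⟩

end Main

section Exactness

variable {k : Type} [Field k] {T N H A : Type} [Ring T] [Bialgebra k T] [Ring N] [Bialgebra k N]
  [Ring H] [Bialgebra k H] [CommRing A] [Algebra k A]
  [Coalgebra.IsCocomm k T] [Coalgebra.IsCocomm k N] [Coalgebra.IsCocomm k H]
  {a : Point k (T ⊗[k] N) N} {iN : N →ₐc[k] H} {iT : T →ₐc[k] H}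

open Point

lemma isZ2_resNN_and_isTStable (h : IsSmashProduct a.lin iN iT) {F : Reg k (H ⊗[k] H) A}
    (hF : IsZ2 F.lin) : IsZ2 (resNN iN F.lin) ∧
      IsTStable a.lin (resNN iN F.lin) (resNN iN (-F).lin) := by
  obtain ⟨f, e, hf⟩ := exists_res iN F
  have e' : resNN iN (-F).lin = (-f).lin := by
    obtain ⟨f', e', hf'⟩ := exists_res iN (-F)
    rw [resNN, e', Reg.lin_inj]
    have := hf' (N ⊗[k] N) fst snd
    rwa [Reg.neg_ev, ← hf, ← Reg.neg_ev, pair_fst_snd, Reg.ev_id, Reg.ev_id] at this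
  have hw (C : Type) [AddCommGroup C] [Module k C] [Coalgebra k C] [Coalgebra.IsCocomm k C] :=
    SmashMonoid.witness_of_cocycle (S := smashPoints h C) ((isZ2_iff F).1 hF C)
  have hr (C : Type) [AddCommGroup C] [Module k C] [Coalgebra k C] [Coalgebra.IsCocomm k C]
      (n n' : Point k C N) : f.ev (pair n n') =
        F.ev (pair ((smashPoints h C).iN n) ((smashPoints h C).iN n')) := hf C n n'
  rw [e', resNN, e]
  constructor
  · rw [isZ2_iff]
    intro C _ _ _ _
    have := (isZ2_iff F).1 hF C
    simp only [hr]
    exact ⟨fun x => by simpa using this.one_left _, fun x => by simpa using this.one_right _,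
      fun x y z => by simpa using this.cocycle _ _ _⟩
  · refine ⟨(F.ev (pair ((ofHom iT).comp fst) ((ofHom iN).comp snd)) -
      F.ev (pair ((ofHom iN).comp (actPt a fst snd)) ((ofHom iT).comp fst))).lin, _,
      (isStabilityWitness_iff f _ h).2 fun C _ _ _ _ => ?_⟩
    simp only [hr]
    convert hw C using 3
    simp; rfl

lemma IotaOf.isZ2_and_isB2_resTT (h : IsSmashProduct a.lin iN iT) {f : Reg k (T ⊗[k] N) A}
    {F : H ⊗[k] H →ₗ[k] A} (hf : IsMeasZ1 a.lin f.lin) (hF : IotaOf iN iT f.lin F) :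
    IsZ2 F ∧ IsB2 (resTT iT F) := by
  obtain ⟨F, rfl, e⟩ := exists_iotaOf h f hF
  obtain ⟨h1, h2⟩ := (isMeasZ1_iff f h).1 hf
  rw [isRegMeas1_iff] at h1
  constructor
  · refine (isZ2_iff F).2 fun C _ _ _ _ => ?_
    exact SmashMonoid.glue_cocycle (S := smashPoints h C) (f := fun _ _ => 0)
      ⟨fun _ => rfl, fun _ => rfl, fun _ _ _ => rfl⟩
      (SmashMonoid.witness_zero (h1 C).1 (h1 C).2) (h2 C) fun x y => by rw [e, zero_add]
  · obtain ⟨F', e', hF'⟩ := exists_res iT F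
    rw [resTT, e', isB2_iff]
    refine ⟨0, fun C _ _ _ _ => ⟨Reg.zero_ev _, fun x y => ?_⟩⟩
    rw [hF', e]
    change f.ev (pair _ ((smashPoints h C).pN ((smashPoints h C).iT y))) = _
    simp [(h1 C).1.map_one]

lemma IotaOf.isMeasB1 (h : IsSmashProduct a.lin iN iT) {f : Reg k (T ⊗[k] N) A}
    {F : H ⊗[k] H →ₗ[k] A} (hf : IsMeasZ1 a.lin f.lin) (hF : IotaOf iN iT f.lin F)
    (hB : IsB2 F) : IsMeasB1 a.lin f.lin := by
  obtain ⟨F, rfl, e⟩ := exists_iotaOf h f hF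
  obtain ⟨τ, hτ⟩ := (isB2_iff F).1 hB
  have h1 := (isRegMeas1_iff f).1 hf.1
  refine isMeasB1_of h (τ := τ.ev (ofHom iN)) fun C _ _ _ _ => ?_
  simp only [Reg.ev_ev]
  exact SmashMonoid.of_inflation_eq_cobound (S := smashPoints h C)
    (f := fun t n => f.ev (pair t n)) (h1 C).2 fun x y => by rw [← e, (hτ C).2]

lemma exists_resTN (h : IsSmashProduct a.lin iN iT) (F : Reg k (H ⊗[k] H) A) :
    ∃ g : Reg k (T ⊗[k] N) A,
    ∀ (C : Type) [AddCommGroup C] [Module k C] [Coalgebra k C] [Coalgebra.IsCocomm k C]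
      (t : Point k C T) (n : Point k C N), g.ev (pair t n) =
        F.ev (pair ((smashPoints h C).iT t) ((smashPoints h C).iN n)) := by
  refine ⟨F.ev (pair ((ofHom iT).comp fst) ((ofHom iN).comp snd)), fun C _ _ _ _ t n => ?_⟩
  simp; rfl

lemma isB2_resNN_iff (h : IsSmashProduct a.lin iN iT) {F : Reg k (H ⊗[k] H) A}
    (hF : IsZ2 F.lin) (hT : IsB2 (resTT iT F.lin)) :
    IsB2 (resNN iN F.lin) ↔ ∃ (f : T ⊗[k] N →ₗ[k] A) (F' : H ⊗[k] H →ₗ[k] A),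
      IsMeasZ1 a.lin f ∧ IotaOf iN iT f F' ∧ Cohomologous2 F.lin F' := by
  constructor
  · intro hN
    obtain ⟨fN, eN, hfN⟩ := exists_res iN F
    have hN' : Cohomologous2 (resNN iN F.lin) (0 : Reg k (N ⊗[k] N) A).lin := by
      rw [resNN, eN] at hN ⊢
      exact (isB2_iff_cohomologous2_zero fN).1 hN
    obtain ⟨τ, F₁, hF₁⟩ := exists_adjust h hF hT hN'
    obtain ⟨g, hg⟩ := exists_resTN h F₁
    have hw (C : Type) [AddCommGroup C] [Module k C] [Coalgebra k C] [Coalgebra.IsCocomm k C] :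
        (smashPoints h C).Witness (fun _ _ => 0) (fun t n => g.ev (pair t n)) := by
      obtain ⟨-, -, hc, hNN, hNT, hTT⟩ := hF₁ C
      have := SmashMonoid.witness_of_cocycle (S := smashPoints h C) hc
      simpa [hNN, hNT, hg] using this
    refine ⟨g.lin, (g.ev (pair ((projT h).comp fst) ((projN h).comp snd))).lin,
      (isMeasZ1_iff g h).2 ⟨(isRegMeas1_iff g).2 fun C _ _ _ _ =>
        ⟨(hw C).measures, (hw C).one_left⟩, fun C _ _ _ _ t s n => ?_⟩, ?_, ?_⟩
    · obtain ⟨-, -, hc, hNN, hNT, hTT⟩ := hF₁ C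
      simpa only [hg] using SmashMonoid.delta_eq_zero_of_cocycle (S := smashPoints h C) hc hNT
        hTT t s n
    · rw [iotaOf_iff h, Reg.ev_lin, pair_fst_comp_snd_comp_lin]
    · refine (cohomologous2_iff _ _).2 ⟨τ, fun C _ _ _ _ => ⟨(hF₁ C).1, fun x y => ?_⟩⟩
      obtain ⟨-, he, hc, hNN, hNT, hTT⟩ := hF₁ C
      have := SmashMonoid.cocycle_eq (S := smashPoints h C) hc hNT hTT x y
      simp only [hNN, Reg.zero_ev, zero_add, ← hg, he] at this
      rw [sub_eq_iff_eq_add.1 this, Reg.ev_ev, pair_comp, comp_comp, comp_comp, fst_comp_pair,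
        snd_comp_pair]
      rfl
  · rintro ⟨f, F', hf, hF', hc⟩
    obtain ⟨f, rfl, -⟩ := Reg.exists_of_isConvInv hf.1.2.2.choose_spec
    obtain ⟨F', rfl, e⟩ := exists_iotaOf h f hF'
    obtain ⟨τ, hτ⟩ := (cohomologous2_iff _ _).1 hc
    obtain ⟨fN, eN, hfN⟩ := exists_res iN F
    rw [resNN, eN]
    refine (isB2_iff fN).2 ⟨τ.ev (ofHom iN), fun C _ _ _ _ => ⟨?_, fun n n' => ?_⟩⟩
    · rw [Reg.ev_ev, ofHom_comp_one, (hτ C).1]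
    · rw [hfN, (hτ C).2, e]
      change f.ev (pair ((smashPoints h C).pT ((smashPoints h C).iN n)) _) + _ = _
      simp [((isRegMeas1_iff f).1 hf.1 C).2, ofHom_comp_mul]

omit [Coalgebra.IsCocomm k H] in
lemma isMeasZ2_measCobound (h : IsSmashProduct a.lin iN iT) {f : Reg k (N ⊗[k] N) A}
    {g : Reg k (T ⊗[k] N) A} (hg : IsStabilityWitness a.lin f.lin (-f).lin g.lin (-g).lin) :
    IsMeasZ2 a.lin (measCobound a.lin g.lin (-g).lin) := by
  obtain ⟨d, e, hd⟩ := exists_measCobound g h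
  rw [e, isMeasZ2_iff d h]
  intro C _ _ _ _
  simp only [hd]
  exact ((isStabilityWitness_iff f g h).1 hg C).delta_isMeasCocycle

omit [Coalgebra.IsCocomm k H] in
lemma isRegMeas1_sub (h : IsSmashProduct a.lin iN iT) {f : Reg k (N ⊗[k] N) A}
    {g g' : Reg k (T ⊗[k] N) A}
    (hg : IsStabilityWitness a.lin f.lin (-f).lin g.lin (-g).lin)
    (hg' : IsStabilityWitness a.lin f.lin (-f).lin g'.lin (-g').lin) :
    IsRegMeas1 (g - g').lin := by
  refine (isRegMeas1_iff _).2 fun C _ _ _ _ => ?_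
  have := ((isStabilityWitness_iff f g h).1 hg C).sub ((isStabilityWitness_iff f g' h).1 hg' C)
  simp only [sub_self] at this
  simp only [Reg.sub_ev]
  exact ⟨this.measures, this.one_left⟩

omit [Coalgebra.IsCocomm k H] in
lemma measCohomologous2_measCobound (h : IsSmashProduct a.lin iN iT) {f : Reg k (N ⊗[k] N) A}
    {g g' : Reg k (T ⊗[k] N) A}
    (hg : IsStabilityWitness a.lin f.lin (-f).lin g.lin (-g).lin)
    (hg' : IsStabilityWitness a.lin f.lin (-f).lin g'.lin (-g').lin) :
    MeasCohomologous2 a.lin (measCobound a.lin g.lin (-g).lin)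
      (measCobound a.lin g'.lin (-g').lin) := by
  obtain ⟨d, e, hd⟩ := exists_measCobound g h
  obtain ⟨d', e', hd'⟩ := exists_measCobound g' h
  rw [e, e', measCohomologous2_iff d d' h]
  refine ⟨g - g', isRegMeas1_sub h hg hg', fun C _ _ _ _ t s n => ?_⟩
  simp only [hd, hd', SmashMonoid.delta, Reg.sub_ev]
  abel

omit [Coalgebra.IsCocomm k H] in
lemma exists_twist (h : IsSmashProduct a.lin iN iT) (τ : Reg k N A) :
    ∃ g : Reg k (T ⊗[k] N) A,
    ∀ (C : Type) [AddCommGroup C] [Module k C] [Coalgebra k C] [Coalgebra.IsCocomm k C]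
      (t : Point k C T) (n : Point k C N),
        g.ev (pair t n) = τ.ev n - τ.ev ((smashPoints h C).act t n) := by
  refine ⟨τ.ev snd - τ.ev (actPt a fst snd), fun C _ _ _ _ t n => ?_⟩
  simp; rfl

omit [Coalgebra.IsCocomm k H] in
lemma isMeasB2_measCobound_of_isB2 (h : IsSmashProduct a.lin iN iT) {f : Reg k (N ⊗[k] N) A}
    {g : Reg k (T ⊗[k] N) A} (hf : IsB2 f.lin)
    (hg : IsStabilityWitness a.lin f.lin (-f).lin g.lin (-g).lin) :
    IsMeasB2 a.lin (measCobound a.lin g.lin (-g).lin) := by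
  obtain ⟨d, e, hd⟩ := exists_measCobound g h
  obtain ⟨τ, hτ⟩ := (isB2_iff f).1 hf
  obtain ⟨g', hg'⟩ := exists_twist h τ
  have hw : IsStabilityWitness a.lin f.lin (-f).lin g'.lin (-g').lin := by
    refine (isStabilityWitness_iff f g' h).2 fun C _ _ _ _ => ?_
    simp only [(hτ C).2, hg']
    exact SmashMonoid.witness_of_cobound (S := smashPoints h C) fun n => τ.ev n
  rw [e, isMeasB2_iff d h]
  refine ⟨g - g', isRegMeas1_sub h hg hw, fun C _ _ _ _ t s n => ?_⟩
  have := SmashMonoid.delta_cobound (S := smashPoints h C) (fun n => τ.ev n) t s n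
  simp only [← hg'] at this
  rw [hd, ← sub_zero (SmashMonoid.delta _ _ _ _ _), ← this]
  simp only [SmashMonoid.delta, Reg.sub_ev]
  abel

lemma isMeasB2_measCobound_iff (h : IsSmashProduct a.lin iN iT) {f : Reg k (N ⊗[k] N) A}
    {g : Reg k (T ⊗[k] N) A} (hf : IsZ2 f.lin)
    (hg : IsStabilityWitness a.lin f.lin (-f).lin g.lin (-g).lin) :
    IsMeasB2 a.lin (measCobound a.lin g.lin (-g).lin) ↔ ∃ F : H ⊗[k] H →ₗ[k] A,
      IsZ2 F ∧ IsB2 (resTT iT F) ∧ Cohomologous2 (resNN iN F) f.lin := by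
  obtain ⟨d, e, hd⟩ := exists_measCobound g h
  have hw := (isStabilityWitness_iff f g h).1 hg
  have hc := (isZ2_iff f).1 hf
  rw [e, isMeasB2_iff d h]
  constructor
  · rintro ⟨m, hm, he⟩
    have hm := (isRegMeas1_iff m).1 hm
    have hw' (C : Type) [AddCommGroup C] [Module k C] [Coalgebra k C] [Coalgebra.IsCocomm k C] :
        (smashPoints h C).Witness (fun n n' => f.ev (pair n n'))
          (fun t n => (g - m).ev (pair t n)) := by
      simpa only [sub_zero, Reg.sub_ev] using
        (hw C).sub (SmashMonoid.witness_zero (S := smashPoints h C) (hm C).1 (hm C).2)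
    obtain ⟨F, hF⟩ := exists_glue h f (g - m)
    refine ⟨F.lin, (isZ2_iff F).2 fun C _ _ _ _ => ?_, ?_, ?_⟩
    · refine SmashMonoid.glue_cocycle (hc C) (hw' C) (fun t s n => ?_) (hF C)
      have := (hd C t s n).symm.trans (he C t s n)
      rw [← sub_eq_zero] at this
      rw [← this]
      simp only [SmashMonoid.delta, Reg.sub_ev]
      abel
    · obtain ⟨F', e', hF'⟩ := exists_res iT F
      rw [resTT, e', isB2_iff]
      refine ⟨0, fun C _ _ _ _ => ⟨Reg.zero_ev _, fun x y => ?_⟩⟩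
      rw [hF']
      change F.ev (pair ((smashPoints h C).iT x) ((smashPoints h C).iT y)) = _
      rw [hF]
      simp only [SmashMonoid.pN_iT, SmashMonoid.act_one, SmashMonoid.pT_iT, (hw' C).one_right,
        (hc C).one_right]
      simp
    · obtain ⟨F', e', hF'⟩ := exists_res iN F
      rw [resNN, e', cohomologous2_iff]
      refine ⟨0, fun C _ _ _ _ => ⟨Reg.zero_ev _, fun x y => ?_⟩⟩
      rw [hF']
      change F.ev (pair ((smashPoints h C).iN x) ((smashPoints h C).iN y)) = _
      rw [hF]
      simp only [SmashMonoid.pN_iN, SmashMonoid.one_act, SmashMonoid.pT_iN, (hw' C).one_left]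
      simp
  · rintro ⟨F, hF, hT, hN⟩
    obtain ⟨F, rfl, -⟩ := Reg.exists_of_isConvInv hF.2.1.choose_spec
    obtain ⟨τ, F₁, hF₁⟩ := exists_adjust h hF hT hN
    obtain ⟨g', hg'⟩ := exists_resTN h F₁
    have hw' : IsStabilityWitness a.lin f.lin (-f).lin g'.lin (-g').lin := by
      refine (isStabilityWitness_iff f g' h).2 fun C _ _ _ _ => ?_
      obtain ⟨-, -, hc, hNN, hNT, hTT⟩ := hF₁ C
      have := SmashMonoid.witness_of_cocycle (S := smashPoints h C) hc
      simpa only [hNN, hNT, hg', sub_zero] using this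
    refine ⟨g - g', isRegMeas1_sub h hg hw', fun C _ _ _ _ t s n => ?_⟩
    obtain ⟨-, -, hc, hNN, hNT, hTT⟩ := hF₁ C
    have := SmashMonoid.delta_eq_zero_of_cocycle (S := smashPoints h C) hc hNT hTT t s n
    simp only [← hg'] at this
    rw [hd, ← sub_zero (SmashMonoid.delta _ _ _ _ _), ← this]
    simp only [SmashMonoid.delta, Reg.sub_ev]
    abel

lemma JOf.isZ3_and_isB3 (h : IsSmashProduct a.lin iN iT) {f : Reg k ((T ⊗[k] T) ⊗[k] N) A}
    {J : (H ⊗[k] H) ⊗[k] H →ₗ[k] A} (hf : IsMeasZ2 a.lin f.lin) (hJ : JOf iN iT f.lin J) :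
    IsZ3 J ∧ IsB3 (J ∘ₗ TensorProduct.map
      (TensorProduct.map iT.toLinearMap iT.toLinearMap) iT.toLinearMap) := by
  obtain ⟨J, rfl, e⟩ := exists_jOf h f hJ
  have hf := (isMeasZ2_iff f h).1 hf
  constructor
  · refine (isZ3_iff J).2 fun C _ _ _ _ => ?_
    simp only [e]
    exact SmashMonoid.cocycle3_of_measCocycle (hf C)
  · obtain ⟨J', e', hJ'⟩ := exists_res_triple iT J
    rw [e', isB3_iff]
    refine ⟨0, fun C _ _ _ _ => ⟨by simp, fun x y z => ?_⟩⟩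
    rw [hJ', e]
    change f.ev (pair _ ((smashPoints h C).pN ((smashPoints h C).iT z))) = _
    simp [((hf C).meas _ _).2]

lemma JOf.isB3 (h : IsSmashProduct a.lin iN iT) {f : Reg k ((T ⊗[k] T) ⊗[k] N) A}
    {J : (H ⊗[k] H) ⊗[k] H →ₗ[k] A} (hJ : JOf iN iT f.lin J) {f₀ : Reg k (N ⊗[k] N) A}
    {g : Reg k (T ⊗[k] N) A} (hf : IsZ2 f₀.lin)
    (hg : IsStabilityWitness a.lin f₀.lin (-f₀).lin g.lin (-g).lin)
    (he : ∀ (C : Type) [AddCommGroup C] [Module k C] [Coalgebra k C] [Coalgebra.IsCocomm k C]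
      (t s : Point k C T) (n : Point k C N), f.ev (pair (pair t s) n) =
        (smashPoints h C).delta (fun t n => g.ev (pair t n)) t s n) : IsB3 J := by
  obtain ⟨J, rfl, e⟩ := exists_jOf h f hJ
  obtain ⟨v, hv⟩ := exists_glue h f₀ g
  refine (isB3_iff J).2 ⟨v, fun C _ _ _ _ => ⟨fun x => ?_, fun x y z => ?_⟩⟩
  · exact SmashMonoid.glue_one ((isZ2_iff f₀).1 hf C) ((isStabilityWitness_iff f₀ g h).1 hg C)
      (hv C) x
  · rw [e, he]
    exact (SmashMonoid.cobound_glue ((isZ2_iff f₀).1 hf C)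
      ((isStabilityWitness_iff f₀ g h).1 hg C) (hv C) x y z).symm

omit [Coalgebra.IsCocomm k H] in
lemma isStabilityWitness_add (h : IsSmashProduct a.lin iN iT) {f : Reg k (N ⊗[k] N) A}
    {g m : Reg k (T ⊗[k] N) A} (hm : IsRegMeas1 m.lin)
    (hg : IsStabilityWitness a.lin f.lin (-f).lin g.lin (-g).lin) :
    IsStabilityWitness a.lin f.lin (-f).lin (g + m).lin (-(g + m)).lin := by
  refine (isStabilityWitness_iff f _ h).2 fun C _ _ _ _ => ?_
  have hm := (isRegMeas1_iff _).1 hm C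
  have h0 : (smashPoints h C).Witness (fun _ _ => (0 : Reg k C A)) fun _ _ => 0 :=
    SmashMonoid.witness_zero ⟨by simp, by simp⟩ (by simp)
  simpa only [sub_zero, Reg.add_ev, sub_neg_eq_add, zero_sub] using
    ((isStabilityWitness_iff f g h).1 hg C).sub
      (h0.sub (SmashMonoid.witness_zero (S := smashPoints h C) hm.1 hm.2))

omit [Coalgebra.IsCocomm k H] in
lemma isStabilityWitness_zero (h : IsSmashProduct a.lin iN iT) :
    IsStabilityWitness a.lin (0 : Reg k (N ⊗[k] N) A).lin (-0 : Reg k (N ⊗[k] N) A).lin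
      (0 : Reg k (T ⊗[k] N) A).lin (-0 : Reg k (T ⊗[k] N) A).lin :=
  (isStabilityWitness_iff _ _ h).2 fun C _ _ _ _ => by constructor <;> simp

lemma JOf.isB3_of_isMeasB2 (h : IsSmashProduct a.lin iN iT) {f : (T ⊗[k] T) ⊗[k] N →ₗ[k] A}
    {J : (H ⊗[k] H) ⊗[k] H →ₗ[k] A} (hf : IsMeasB2 a.lin f) (hJ : JOf iN iT f J) : IsB3 J := by
  obtain ⟨g, ginv, hg, hi, rfl⟩ := hf
  obtain ⟨g, rfl, rfl⟩ := Reg.exists_of_isConvInv hi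
  obtain ⟨d, e, hd⟩ := exists_measCobound g h
  rw [e] at hJ
  have := isStabilityWitness_add h hg (isStabilityWitness_zero h)
  rw [zero_add] at this
  exact hJ.isB3 h isZ2_zero this hd

lemma JOf.isB3_iff (h : IsSmashProduct a.lin iN iT) {f : Reg k ((T ⊗[k] T) ⊗[k] N) A}
    {J : (H ⊗[k] H) ⊗[k] H →ₗ[k] A} (hf : IsMeasZ2 a.lin f.lin) (hJ : JOf iN iT f.lin J) :
    IsB3 J ↔ ∃ (f₀ f₀inv : N ⊗[k] N →ₗ[k] A) (g₀ g₀inv : T ⊗[k] N →ₗ[k] A),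
      IsZ2 f₀ ∧ IsConvInv f₀ f₀inv ∧ IsStabilityWitness a.lin f₀ f₀inv g₀ g₀inv
        ∧ MeasCohomologous2 a.lin f.lin (measCobound a.lin g₀ g₀inv) := by
  constructor
  · intro hB
    obtain ⟨J, rfl, e⟩ := exists_jOf h f hJ
    obtain ⟨v, hv⟩ := (SmashPaper.isB3_iff J).1 hB
    have hf := (isMeasZ2_iff f h).1 hf
    have key (C : Type) [AddCommGroup C] [Module k C] [Coalgebra k C] [Coalgebra.IsCocomm k C] :=
      SmashMonoid.of_cobound_eq (hf C) (v := fun x y => v.ev (pair x y))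
        (fun x => ((hv C).1 x).1) (fun x => ((hv C).1 x).2)
        (fun x y z => by rw [← e, (hv C).2])
    have hf₀ : ∃ f₀ : Reg k (N ⊗[k] N) A,
        ∀ (C : Type) [AddCommGroup C] [Module k C] [Coalgebra k C] [Coalgebra.IsCocomm k C]
        (n n' : Point k C N), f₀.ev (pair n n') =
          v.ev (pair ((smashPoints h C).iN n) ((smashPoints h C).iN n')) :=
      (exists_res iN v).imp fun _ => And.right
    have hg₀ : ∃ g₀ : Reg k (T ⊗[k] N) A,
        ∀ (C : Type) [AddCommGroup C] [Module k C] [Coalgebra k C] [Coalgebra.IsCocomm k C]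
        (t : Point k C T) (n : Point k C N), g₀.ev (pair t n) =
          v.ev (pair ((smashPoints h C).iT t) ((smashPoints h C).iN n)) -
          v.ev (pair ((smashPoints h C).iN ((smashPoints h C).act t n))
            ((smashPoints h C).iT t)) := by
      refine ⟨v.ev (pair ((ofHom iT).comp fst) ((ofHom iN).comp snd)) -
        v.ev (pair ((ofHom iN).comp (actPt a fst snd)) ((ofHom iT).comp fst)),
        fun C _ _ _ _ t n => ?_⟩
      simp; rfl
    obtain ⟨f₀, hf₀⟩ := hf₀
    obtain ⟨g₀, hg₀⟩ := hg₀
    simp only [← hf₀, ← hg₀] at key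
    obtain ⟨d, hd, hd'⟩ := exists_measCobound g₀ h
    refine ⟨f₀.lin, (-f₀).lin, g₀.lin, (-g₀).lin, (isZ2_iff f₀).2 fun C _ _ _ _ => (key C).1,
      f₀.isConvInv, (isStabilityWitness_iff f₀ g₀ h).2 fun C _ _ _ _ => (key C).2.1, ?_⟩
    rw [hd, measCohomologous2_iff f d h]
    refine ⟨0, (isRegMeas1_iff 0).2 fun C _ _ _ _ => ⟨⟨by simp, by simp⟩, by simp⟩,
      fun C _ _ _ _ t s n => ?_⟩
    rw [hd', (key C).2.2]
    simp [SmashMonoid.delta]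
  · rintro ⟨f₀, f₀inv, g₀, g₀inv, hz, hi, hw, hc⟩
    obtain ⟨f₀, rfl, rfl⟩ := Reg.exists_of_isConvInv hi
    obtain ⟨g₀, rfl, rfl⟩ := Reg.exists_of_isConvInv hw.2.2.1
    obtain ⟨d, hd, hd'⟩ := exists_measCobound g₀ h
    rw [hd] at hc
    obtain ⟨m, hm, he⟩ := (measCohomologous2_iff f d h).1 hc
    refine hJ.isB3 h hz (isStabilityWitness_add h hm hw) fun C _ _ _ _ t s n => ?_
    rw [he, hd']
    simp only [SmashMonoid.delta, Reg.add_ev]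
    abel

end Exactness

end SmashPaper

/-- **Theorem (five term exact sequence for a smash product).**
Let `H = N ⋊ T` be the smash product of cocommutative Hopf algebras `N` and `T` over a
field `k`, and let the commutative `k`-algebra `A` be a trivial `H`-module.  Then:

(i) the restriction to `N ⊗ N` of any Sweedler 2-cocycle on `H` representing a class of
`H̃²(H,A)` is a 2-cocycle on `N` whose class is `T`-stable;

(ii) the five-term sequence
`0 → H¹_meas(T,Hom(N,A)) →(ι) H̃²(H,A) →(res) H²(N,A)^T →(d) H²_meas(T,Hom(N,A)) →(j) H̃³(H,A)`
is exact.  Here `ι f` is (the class of) the 2-cocycle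
`(n⋊t) ⊗ (n'⋊t') ↦ ε(n) f(t)(n') ε(t')` (`IotaOf`), `res` is induced by restriction to
`N ⊗ N`, `d` sends the class of a 2-cocycle `f` on `N` with stability witness `g` to the
class of the measuring 2-cocycle
`f'(t⊗t')(n) = ∑ g(t'₍₁₎⊗n₍₁₎) g⁻¹(t₍₁₎t'₍₂₎⊗n₍₂₎) g(t₍₂₎⊗t'₍₃₎(n₍₃₎))`
(`measCobound μ g ginv`, a class independent of the witness `g`), and `j f` is (the
class of) the 3-cocycle
`(n⋊t) ⊗ (n'⋊t') ⊗ (n''⋊t'') ↦ ε(n)ε(n') f(t⊗t')(n'') ε(t'')` (`JOf`).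
Exactness is stated elementwise, at the level of cocycles and coboundaries. -/
theorem five_term_exact_sequence
    {k : Type} [Field k] {T N H A : Type}
    [Ring T] [HopfAlgebra k T] [Ring N] [HopfAlgebra k N]
    [Ring H] [HopfAlgebra k H] [CommRing A] [Algebra k A]
    (hTcc : IsCocomm k T) (hNcc : IsCocomm k N)
    (μ : T ⊗[k] N →ₗ[k] N) (iN : N →ₐc[k] H) (iT : T →ₐc[k] H)
    (hsmash : IsSmashProduct μ iN iT) :
    -- (i) restriction of a class of `H̃²(H,A)` to `N` is a `T`-stable 2-cocycle
    (∀ F Finv : H ⊗[k] H →ₗ[k] A,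
      IsZ2 F → IsConvInv F Finv → IsB2 (resTT iT F) →
        IsZ2 (resNN iN F) ∧ IsTStable μ (resNN iN F) (resNN iN Finv))
    -- (ii) exactness of the five term sequence:
    -- `ι f` exists, ...
    ∧ (∀ f : T ⊗[k] N →ₗ[k] A, ∃ F, IotaOf iN iT f F)
    -- ... is a 2-cocycle whose restriction to `T` is a coboundary, ...
    ∧ (∀ (f : T ⊗[k] N →ₗ[k] A) (F : H ⊗[k] H →ₗ[k] A),
        IsMeasZ1 μ f → IotaOf iN iT f F → IsZ2 F ∧ IsB2 (resTT iT F))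
    -- ... is compatible with products, ...
    ∧ (∀ (f f' : T ⊗[k] N →ₗ[k] A) (F F' : H ⊗[k] H →ₗ[k] A),
        IotaOf iN iT f F → IotaOf iN iT f' F' → IotaOf iN iT (conv f f') (conv F F'))
    -- ... and `ι` is injective (exactness at `H¹_meas(T,Hom(N,A))`)
    ∧ (∀ (f : T ⊗[k] N →ₗ[k] A) (F : H ⊗[k] H →ₗ[k] A),
        IsMeasZ1 μ f → IotaOf iN iT f F → IsB2 F → IsMeasB1 μ f)
    -- exactness at `H̃²(H,A)`: image of `ι` = kernel of `res`
    ∧ (∀ F : H ⊗[k] H →ₗ[k] A,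
        IsZ2 F → IsB2 (resTT iT F) →
          (IsB2 (resNN iN F) ↔
            ∃ (f : T ⊗[k] N →ₗ[k] A) (F' : H ⊗[k] H →ₗ[k] A),
              IsMeasZ1 μ f ∧ IotaOf iN iT f F' ∧ Cohomologous2 F F'))
    -- `d` is well defined: `d f` is a measuring 2-cocycle ...
    ∧ (∀ (f finv : N ⊗[k] N →ₗ[k] A) (g ginv : T ⊗[k] N →ₗ[k] A),
        IsZ2 f → IsConvInv f finv → IsStabilityWitness μ f finv g ginv →
          IsMeasZ2 μ (measCobound μ g ginv))
    -- ... whose class does not depend on the choice of the witness `g` ...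
    ∧ (∀ (f finv : N ⊗[k] N →ₗ[k] A) (g ginv g' ginv' : T ⊗[k] N →ₗ[k] A),
        IsZ2 f → IsConvInv f finv →
        IsStabilityWitness μ f finv g ginv → IsStabilityWitness μ f finv g' ginv' →
          MeasCohomologous2 μ (measCobound μ g ginv) (measCobound μ g' ginv'))
    -- ... and kills coboundaries
    ∧ (∀ (f finv : N ⊗[k] N →ₗ[k] A) (g ginv : T ⊗[k] N →ₗ[k] A),
        IsB2 f → IsConvInv f finv → IsStabilityWitness μ f finv g ginv →
          IsMeasB2 μ (measCobound μ g ginv))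
    -- exactness at `H²(N,A)^T`: image of `res` = kernel of `d`
    ∧ (∀ (f finv : N ⊗[k] N →ₗ[k] A) (g ginv : T ⊗[k] N →ₗ[k] A),
        IsZ2 f → IsConvInv f finv → IsStabilityWitness μ f finv g ginv →
          (IsMeasB2 μ (measCobound μ g ginv) ↔
            ∃ F : H ⊗[k] H →ₗ[k] A,
              IsZ2 F ∧ IsB2 (resTT iT F) ∧ Cohomologous2 (resNN iN F) f))
    -- `j` is well defined: `j f` exists, is a 3-cocycle trivial on `T`, and kills
    -- measuring coboundaries
    ∧ (∀ f : (T ⊗[k] T) ⊗[k] N →ₗ[k] A, ∃ J, JOf iN iT f J)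
    ∧ (∀ (f : (T ⊗[k] T) ⊗[k] N →ₗ[k] A) (J : (H ⊗[k] H) ⊗[k] H →ₗ[k] A),
        IsMeasZ2 μ f → JOf iN iT f J →
          IsZ3 J ∧ IsB3 (J ∘ₗ TensorProduct.map
            (TensorProduct.map iT.toLinearMap iT.toLinearMap) iT.toLinearMap))
    ∧ (∀ (f : (T ⊗[k] T) ⊗[k] N →ₗ[k] A) (J : (H ⊗[k] H) ⊗[k] H →ₗ[k] A),
        IsMeasB2 μ f → JOf iN iT f J → IsB3 J)
    -- exactness at `H²_meas(T,Hom(N,A))`: image of `d` = kernel of `j`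
    ∧ (∀ (f : (T ⊗[k] T) ⊗[k] N →ₗ[k] A) (J : (H ⊗[k] H) ⊗[k] H →ₗ[k] A),
        IsMeasZ2 μ f → JOf iN iT f J →
          (IsB3 J ↔
            ∃ (f₀ f₀inv : N ⊗[k] N →ₗ[k] A) (g₀ g₀inv : T ⊗[k] N →ₗ[k] A),
              IsZ2 f₀ ∧ IsConvInv f₀ f₀inv ∧ IsStabilityWitness μ f₀ f₀inv g₀ g₀inv
                ∧ MeasCohomologous2 μ f (measCobound μ g₀ g₀inv))) := by
  have : Coalgebra.IsCocomm k T := ⟨hTcc⟩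
  have : Coalgebra.IsCocomm k N := ⟨hNcc⟩
  have : Coalgebra.IsCocomm k H := hsmash.isCocomm
  obtain ⟨a, rfl⟩ := hsmash.act.exists_point
  refine ⟨?_, fun f => ⟨_, (iotaOf_iff hsmash f _).2 rfl⟩, ?_, fun f f' F F' => IotaOf.conv hsmash,
    ?_, ?_, ?_, ?_, ?_, ?_, fun f => ⟨_, (jOf_iff hsmash f _).2 rfl⟩, ?_,
    fun f J hf hJ => hJ.isB3_of_isMeasB2 hsmash hf, ?_⟩
  · intro F Finv hF hi _
    obtain ⟨F, rfl, rfl⟩ := Reg.exists_of_isConvInv hi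
    exact isZ2_resNN_and_isTStable hsmash hF
  · intro f F hf hF
    obtain ⟨f, rfl⟩ := Reg.exists_of_isConvInvertible hf.1.2.2
    exact hF.isZ2_and_isB2_resTT hsmash hf
  · intro f F hf hF hB
    obtain ⟨f, rfl⟩ := Reg.exists_of_isConvInvertible hf.1.2.2
    exact hF.isMeasB1 hsmash hf hB
  · intro F hF hT
    obtain ⟨F, rfl⟩ := Reg.exists_of_isConvInvertible hF.2.1
    exact isB2_resNN_iff hsmash hF hT
  · intro f finv g ginv _ hi hg
    obtain ⟨f, rfl, rfl⟩ := Reg.exists_of_isConvInv hi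
    obtain ⟨g, rfl, rfl⟩ := Reg.exists_of_isConvInv hg.2.2.1
    exact isMeasZ2_measCobound hsmash hg
  · intro f finv g ginv g' ginv' _ hi hg hg'
    obtain ⟨f, rfl, rfl⟩ := Reg.exists_of_isConvInv hi
    obtain ⟨g, rfl, rfl⟩ := Reg.exists_of_isConvInv hg.2.2.1
    obtain ⟨g', rfl, rfl⟩ := Reg.exists_of_isConvInv hg'.2.2.1
    exact measCohomologous2_measCobound hsmash hg hg'
  · intro f finv g ginv hf hi hg
    obtain ⟨f, rfl, rfl⟩ := Reg.exists_of_isConvInv hi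
    obtain ⟨g, rfl, rfl⟩ := Reg.exists_of_isConvInv hg.2.2.1
    exact isMeasB2_measCobound_of_isB2 hsmash hf hg
  · intro f finv g ginv hf hi hg
    obtain ⟨f, rfl, rfl⟩ := Reg.exists_of_isConvInv hi
    obtain ⟨g, rfl, rfl⟩ := Reg.exists_of_isConvInv hg.2.2.1
    exact isMeasB2_measCobound_iff hsmash hf hg
  · intro f J hf hJ
    obtain ⟨f, rfl⟩ := Reg.exists_of_isConvInvertible hf.1.2.2
    exact hJ.isZ3_and_isB3 hsmash hf
  · intro f J hf hJ
    obtain ⟨f, rfl⟩ := Reg.exists_of_isConvInvertible hf.1.2.2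
    exact hJ.isB3_iff hsmash hf
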